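/- arXiv:1602.06094 — 4 statements merged into one kernel-verified Lean document; each statement's English description precedes it below -/
import Mathlib

section
/- Every feckly clean Bézout duo-domain is an elementary divisor ring. -/
/-- A (not necessarily square) matrix `A` over a ring admits diagonal reduction if there are
invertible matrices `P`, `Q` such that `P * A * Q` is a diagonal matrix `(d_ij)` in which each
diagonal entry `d_{i+1,i+1}` is a full divisor of `d_ii`, i.e.
`R·d_{i+1,i+1}·R ⊆ d_ii·R ∩ R·d_ii`. -/
def AdmitsDiagonalReduction {R : Type*} [Ring R] {m n : ℕ}
    (A : Matrix (Fin m) (Fin n) R) : Prop :=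
  ∃ (P : Matrix (Fin m) (Fin m) R) (Q : Matrix (Fin n) (Fin n) R),
    IsUnit P ∧ IsUnit Q ∧
    (∀ (i : Fin m) (j : Fin n), (i : ℕ) ≠ (j : ℕ) → (P * A * Q) i j = 0) ∧
    (∀ (i : Fin m) (j : Fin n) (i' : Fin m) (j' : Fin n),
      (i : ℕ) = (j : ℕ) → (i' : ℕ) = (j' : ℕ) → (i' : ℕ) = (i : ℕ) + 1 →
      ∀ x y : R,
        (∃ u : R, x * (P * A * Q) i' j' * y = (P * A * Q) i j * u) ∧
        (∃ v : R, x * (P * A * Q) i' j' * y = v * (P * A * Q) i j))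

/-- A ring is an elementary divisor ring if every matrix admits a diagonal reduction. -/
def ElementaryDivisorRing (R : Type*) [Ring R] : Prop :=
  ∀ (m n : ℕ) (A : Matrix (Fin m) (Fin n) R), AdmitsDiagonalReduction A

/-- A ring is Bézout if every finitely generated left ideal and every finitely generated
right ideal is principal. (Right ideals are submodules of `R` over `Rᵐᵒᵖ`.) -/
def IsBezoutRing (R : Type*) [Ring R] : Prop :=
  (∀ I : Ideal R, I.FG → ∃ d : R, I = Ideal.span {d}) ∧
  (∀ I : Submodule Rᵐᵒᵖ R, I.FG → ∃ d : R, I = Submodule.span Rᵐᵒᵖ {d})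

/-- A ring is duo if every left ideal and every right ideal is two-sided. -/
def IsDuoRing (R : Type*) [Ring R] : Prop :=
  (∀ (I : Ideal R), ∀ a ∈ I, ∀ r : R, a * r ∈ I) ∧
  (∀ (I : Submodule Rᵐᵒᵖ R), ∀ a ∈ I, ∀ r : R, r * a ∈ I)

/-- A ring is left quasi-duo if every maximal left ideal is two-sided. -/
def IsLeftQuasiDuo (R : Type*) [Ring R] : Prop :=
  ∀ I : Ideal R, I.IsMaximal → ∀ a ∈ I, ∀ r : R, a * r ∈ I

/-- A ring is right quasi-duo if every maximal right ideal is two-sided. -/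
def IsRightQuasiDuo (R : Type*) [Ring R] : Prop :=
  ∀ I : Submodule Rᵐᵒᵖ R, IsCoatom I → ∀ a ∈ I, ∀ r : R, r * a ∈ I

/-- A ring has stable range 1 if `aR + bR = R` implies `a + by` is a unit for some `y`. -/
def HasStableRange1 (R : Type*) [Ring R] : Prop :=
  ∀ a b : R, (∃ x y : R, a * x + b * y = 1) → ∃ y : R, IsUnit (a + b * y)

/-- The quotient ring `R/aR`, where `aR` is regarded as the two-sided ideal generated
by `a` (in a duo ring this coincides with the right ideal `aR`). -/
abbrev QuotBy {R : Type*} [Ring R] (a : R) : Type _ :=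
  (TwoSidedIdeal.span {a}).ringCon.Quotient

/-- The Jacobson radical of `R` (the intersection of all maximal left ideals). -/
noncomputable abbrev jacobsonRadical (R : Type*) [Ring R] : Ideal R :=
  Ideal.jacobson (⊥ : Ideal R)

/-- A two-sided ideal `P` is prime if `P ≠ R` and `aRb ⊆ P` implies `a ∈ P` or `b ∈ P`. -/
def IsPrimeTwoSided {R : Type*} [Ring R] (P : TwoSidedIdeal R) : Prop :=
  P ≠ ⊤ ∧ ∀ a b : R, (∀ r : R, a * r * b ∈ P) → a ∈ P ∨ b ∈ P

/-- A ring is a PM ring if every prime two-sided ideal is contained in exactly one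
maximal (two-sided) ideal. -/
def IsPMRing (R : Type*) [Ring R] : Prop :=
  ∀ P : TwoSidedIdeal R, IsPrimeTwoSided P →
    ∃! M : TwoSidedIdeal R, IsCoatom M ∧ P ≤ M

/-- An element `c` is adequate if for every `a` there are `r, s` with `c = rs`,
`rR + aR = R`, and `s'R + aR ≠ R` for every non-invertible divisor `s'` of `s`. -/
def IsAdequateElement {R : Type*} [Ring R] (c : R) : Prop :=
  ∀ a : R, ∃ r s : R, c = r * s ∧ (∃ x y : R, r * x + a * y = 1) ∧
    ∀ s' : R, ¬ IsUnit s' → (∃ u : R, s = s' * u) → ¬ ∃ x y : R, s' * x + a * y = 1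

/-- An element `c` is feckly adequate if for every `a` there are `r, s` with
`c ≡ rs (mod J(R))`, `rR + aR = R`, and `s'R + aR ≠ R` for every non-invertible
divisor `s'` of `s`. -/
def IsFecklyAdequateElement {R : Type*} [Ring R] (c : R) : Prop :=
  ∀ a : R, ∃ r s : R, c - r * s ∈ jacobsonRadical R ∧ (∃ x y : R, r * x + a * y = 1) ∧
    ∀ s' : R, ¬ IsUnit s' → (∃ u : R, s = s' * u) → ¬ ∃ x y : R, s' * x + a * y = 1



open Matrix in
theorem aux_rank_one {R : Type*} [Ring R] {n : ℕ} (c r : Fin n → R)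
    (h : IsUnit (1 + r ⬝ᵥ c)) : IsUnit (1 + vecMulVec c r) := by
  obtain ⟨u, hu⟩ := h
  have hrc : r ⬝ᵥ c = (u : R) - 1 := by rw [hu]; abel
  have key : ∀ (a b : Fin n → R), vecMulVec c a * vecMulVec b r
      = vecMulVec (fun i => c i * (a ⬝ᵥ b)) r := by
    intro a b
    ext i j
    simp only [Matrix.mul_apply, vecMulVec_apply, dotProduct, Finset.mul_sum, Finset.sum_mul,
      mul_assoc]
  have e1 : vecMulVec c r * vecMulVec (fun i => c i * (↑u⁻¹ : R)) r
      = vecMulVec c r - vecMulVec (fun i => c i * (↑u⁻¹ : R)) r := by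
    rw [key]
    ext i j
    have : r ⬝ᵥ (fun i => c i * (↑u⁻¹ : R)) = (r ⬝ᵥ c) * ↑u⁻¹ := by
      simp [dotProduct, Finset.sum_mul, mul_assoc]
    simp [this, vecMulVec_apply, hrc, sub_mul, mul_sub]
  have e2 : vecMulVec (fun i => c i * (↑u⁻¹ : R)) r * vecMulVec c r
      = vecMulVec c r - vecMulVec (fun i => c i * (↑u⁻¹ : R)) r := by
    ext i j
    have : ∑ x, c i * (↑u⁻¹ : R) * r x * (c x * r j) = c i * ↑u⁻¹ * (r ⬝ᵥ c) * r j := by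
      simp only [dotProduct, Finset.mul_sum, Finset.sum_mul, mul_assoc]
    simp only [Matrix.mul_apply, vecMulVec_apply, this, hrc, Matrix.sub_apply]
    simp [sub_mul, mul_sub, mul_assoc]
  refine ⟨⟨1 + vecMulVec c r, 1 - vecMulVec (fun i => c i * (↑u⁻¹ : R)) r, ?_, ?_⟩, rfl⟩
  · rw [add_mul, mul_sub, mul_sub, e1]; simp
  · rw [sub_mul, mul_add, mul_add, e2]; simp

open Matrix in
theorem aux_row {R : Type*} [Ring R] {n : ℕ} (p : Fin (n+1) → R) (h : IsUnit (∑ i, p i)) :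
    ∃ P : Matrix (Fin (n+1)) (Fin (n+1)) R, IsUnit P ∧ P 0 = p := by
  have h1 : IsUnit (1 + vecMulVec (Pi.single (0 : Fin (n+1)) (1 : R))
      (Fin.cons (∑ i, p i - 1) (fun i => p i.succ) : Fin (n+1) → R)) := by
    apply aux_rank_one; simpa using h
  have h2 : IsUnit (1 + vecMulVec (Fin.cons 0 (fun _ => -1) : Fin (n+1) → R)
      (Pi.single (0 : Fin (n+1)) (1 : R))) := by
    apply aux_rank_one; simp
  refine ⟨_, h1.mul h2, ?_⟩
  ext j
  simp only [add_mul, one_mul, mul_add, mul_one]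
  refine Fin.cases ?_ (fun j => ?_) j
  · simp [Matrix.add_apply, Matrix.mul_apply, vecMulVec_apply, Fin.sum_univ_succ]
  · simp [Matrix.add_apply, Matrix.mul_apply, vecMulVec_apply, Fin.sum_univ_succ,
      Matrix.one_apply, Fin.ext_iff]

open Matrix in
theorem aux_col {R : Type*} [Ring R] {n : ℕ} (q : Fin (n+1) → R) (h : IsUnit (∑ i, q i)) :
    ∃ Q : Matrix (Fin (n+1)) (Fin (n+1)) R, IsUnit Q ∧ ∀ i, Q i 0 = q i := by
  have h1 : IsUnit (1 + vecMulVec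
      (Fin.cons (∑ i, q i - 1) (fun i => q i.succ) : Fin (n+1) → R) (Pi.single (0 : Fin (n+1)) (1 : R))) := by
    apply aux_rank_one; simpa using h
  have h2 : IsUnit (1 + vecMulVec (Pi.single (0 : Fin (n+1)) (1 : R))
      (Fin.cons 0 (fun _ => -1) : Fin (n+1) → R)) := by
    apply aux_rank_one; simp
  refine ⟨_, h2.mul h1, ?_⟩
  intro j
  simp only [add_mul, one_mul, mul_add, mul_one]
  refine Fin.cases ?_ (fun j => ?_) j
  · simp [Matrix.add_apply, Matrix.mul_apply, vecMulVec_apply, Fin.sum_univ_succ]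
    abel
  · simp [Matrix.add_apply, Matrix.mul_apply, vecMulVec_apply, Fin.sum_univ_succ,
      Matrix.one_apply, Fin.ext_iff]

/-- Block extension `diag(a, P)`. -/
def auxExt {R : Type*} [Ring R] {m n : ℕ} (a : R) (P : Matrix (Fin m) (Fin n) R) :
    Matrix (Fin (m+1)) (Fin (n+1)) R :=
  Matrix.of (Fin.cons (Fin.cons a 0) (fun i => Fin.cons 0 (P i)))

section
variable {R : Type*} [Ring R] {m n : ℕ} (a : R) (P : Matrix (Fin m) (Fin n) R)

@[simp] theorem auxExt_zz : auxExt a P 0 0 = a := rfl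
@[simp] theorem auxExt_zs (j : Fin n) : auxExt a P 0 j.succ = 0 := rfl
@[simp] theorem auxExt_sz (i : Fin m) : auxExt a P i.succ 0 = 0 := rfl
@[simp] theorem auxExt_ss (i : Fin m) (j : Fin n) : auxExt a P i.succ j.succ = P i j := rfl

theorem auxExt_mul {k : ℕ} (b : R) (Q : Matrix (Fin n) (Fin k) R) :
    auxExt a P * auxExt b Q = auxExt (a * b) (P * Q) := by
  ext i j
  refine Fin.cases ?_ (fun i => ?_) i <;> refine Fin.cases ?_ (fun j => ?_) j <;>
    simp [Matrix.mul_apply, Fin.sum_univ_succ]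

theorem auxExt_one : auxExt (1 : R) (1 : Matrix (Fin m) (Fin m) R) = 1 := by
  ext i j
  refine Fin.cases ?_ (fun i => ?_) i <;> refine Fin.cases ?_ (fun j => ?_) j <;>
    simp [Matrix.one_apply, Fin.ext_iff]

theorem auxExt_isUnit {P : Matrix (Fin m) (Fin m) R} (h : IsUnit P) :
    IsUnit (auxExt 1 P) := by
  obtain ⟨u, rfl⟩ := h
  refine ⟨⟨auxExt 1 (u : Matrix (Fin m) (Fin m) R), auxExt 1 (↑u⁻¹ : Matrix (Fin m) (Fin m) R),
    ?_, ?_⟩, rfl⟩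
  · rw [auxExt_mul]; simp [auxExt_one]
  · rw [auxExt_mul]; simp [auxExt_one]
end

section
variable {R : Type*} [Ring R]

theorem aux_duo_left (hD : IsDuoRing R) (a r : R) : ∃ s, a * r = s * a := by
  have := hD.1 (Ideal.span {a}) a (Ideal.mem_span_singleton_self a) r
  obtain ⟨s, hs⟩ := Ideal.mem_span_singleton'.1 this
  exact ⟨s, hs.symm⟩

theorem aux_duo_right (hD : IsDuoRing R) (a r : R) : ∃ s, r * a = a * s := by
  have := hD.2 (Submodule.span Rᵐᵒᵖ {a}) a (Submodule.mem_span_singleton_self a) r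
  obtain ⟨s, hs⟩ := Submodule.mem_span_singleton.1 this
  exact ⟨s.unop, hs.symm⟩

theorem aux_two (hD : IsDuoRing R) (M : Ideal R) : M.IsTwoSided :=
  ⟨fun {a} b ha => hD.1 M a ha b⟩

theorem aux_prime (hD : IsDuoRing R) (M : Ideal R) (hM : M.IsMaximal) {x y : R}
    (h : x * y ∈ M) : x ∈ M ∨ y ∈ M := by
  by_contra! hc
  obtain ⟨hx, hy⟩ := hc
  obtain ⟨r, m, hm, hr⟩ := hM.exists_inv hy
  obtain ⟨s, hs⟩ := aux_duo_left hD x r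
  apply hx
  have : x = s * (x * y) + x * m := by
    rw [← mul_assoc, ← hs, mul_assoc, ← mul_add, hr, mul_one]
  rw [this]
  exact M.add_mem (M.mul_mem_left _ h) (M.mul_mem_left _ hm)

theorem aux_unit [IsDomain R] (x : R) (h : ∀ M : Ideal R, M.IsMaximal → x ∉ M) :
    IsUnit x := by
  have : Ideal.span {x} = ⊤ := by
    by_contra hc
    obtain ⟨M, hM, hle⟩ := Ideal.exists_le_maximal _ hc
    exact h M hM (hle (Ideal.mem_span_singleton_self x))
  obtain ⟨s, hs⟩ := Ideal.mem_span_singleton'.1 ((Ideal.eq_top_iff_one _).1 this)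
  exact ⟨⟨x, s, mul_eq_one_comm.1 hs, hs⟩, rfl⟩

theorem aux_unit_notMem {x : R} (hx : IsUnit x) (M : Ideal R) (hM : M.IsMaximal) : x ∉ M :=
  fun h => hM.ne_top (Ideal.eq_top_of_isUnit_mem _ h hx)

/-- Partition lemma. -/
theorem aux_part [IsDomain R] (hD : IsDuoRing R)
    (hFC : ∀ a : R, ∃ e : R, IsUnit (a - e) ∧ ∀ r : R, e * r * (1 - e) ∈ jacobsonRadical R)
    {K : Type*} [DecidableEq K] (a : K → R) (s : Finset K) :
    ∀ g : R, (∀ M : Ideal R, M.IsMaximal → (g ∈ M ∨ 1 - g ∈ M)) →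
      (∀ M : Ideal R, M.IsMaximal → g ∉ M → ∑ k ∈ s, a k ∉ M) →
      ∃ e : K → R, ∀ M : Ideal R, M.IsMaximal → (g ∈ M ∧ ∀ k, e k ∈ M) ∨
        (g ∉ M ∧ ∃ k ∈ s, a k ∉ M ∧ 1 - e k ∈ M ∧ ∀ l, l ≠ k → e l ∈ M) := by
  induction s using Finset.induction_on with
  | empty =>
    intro g hg hs
    refine ⟨0, fun M hM => Or.inl ⟨?_, fun k => M.zero_mem⟩⟩
    by_contra hc
    exact hs M hM hc (by simp)
  | insert k₀ s hk ih =>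
    intro g hg hs
    set t := a k₀ + ∑ k ∈ s, a k with ht
    have hs' : ∀ M : Ideal R, M.IsMaximal → g ∉ M → t ∉ M := by
      intro M hM h
      have := hs M hM h
      rwa [Finset.sum_insert hk] at this
    have hone : ∀ M : Ideal R, M.IsMaximal → (1:R) ∉ M := fun M hM =>
      aux_unit_notMem isUnit_one M hM
    have hv : IsUnit (t * g + (1 - g)) := by
      apply aux_unit
      intro M hM hmem
      rcases hg M hM with h | h
      · have h2 : 1 - g ∈ M := by
          simpa using M.sub_mem hmem (M.mul_mem_left t h)
        exact hone M hM (by simpa using M.add_mem h2 h)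
      · have hg' : g ∉ M := fun h' => hone M hM (by simpa using M.add_mem h h')
        have h2 : t * g ∈ M := by simpa using M.sub_mem hmem h
        rcases aux_prime hD M hM h2 with h3 | h3
        · exact hs' M hM hg' h3
        · exact hg' h3
    obtain ⟨v, hv⟩ := hv
    obtain ⟨e, heu, he⟩ := hFC (a k₀ * g * ↑v⁻¹)
    have he' : ∀ M : Ideal R, M.IsMaximal → (e ∈ M ∨ 1 - e ∈ M) := by
      intro M hM
      apply aux_prime hD M hM
      have := he 1
      rw [mul_one] at this
      exact (Ideal.mem_sInf.1 this) ⟨bot_le, hM⟩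
    -- key facts
    have hA : ∀ M : Ideal R, M.IsMaximal → e ∈ M → a k₀ ∉ M := by
      intro M hM h h'
      refine aux_unit_notMem heu M hM (M.sub_mem ?_ h)
      rw [mul_assoc]
      exact hD.1 M _ h' _
    have hBB : ∀ M : Ideal R, M.IsMaximal → g ∉ M → e ∉ M → ∑ k ∈ s, a k ∉ M := by
      intro M hM hgM heM hsum
      have h1e := (he' M hM).resolve_left heM
      have h1g := (hg M hM).resolve_left hgM
      apply aux_unit_notMem heu M hM
      have h1 : a k₀ * g - v ∈ M := by
        have : a k₀ * g - v = -((∑ k ∈ s, a k) * g) - (1 - g) := by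
          rw [hv, ht]; noncomm_ring
        rw [this]
        exact M.sub_mem (M.neg_mem (hD.1 M _ hsum _)) h1g
      have h2 : (a k₀ * g - v) * ↑v⁻¹ ∈ M := hD.1 M _ h1 _
      have : a k₀ * g * ↑v⁻¹ - e = (a k₀ * g - v) * ↑v⁻¹ + (1 - e) := by
        rw [sub_mul]; simp
      rw [this]
      exact M.add_mem h2 h1e
    obtain ⟨ε, hε⟩ := ih (e * g) (by
      intro M hM
      rcases he' M hM with h | h
      · exact Or.inl (hD.1 M _ h _)
      rcases hg M hM with h' | h'
      · exact Or.inl (M.mul_mem_left _ h')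
      right
      have : 1 - e * g = (1 - e) * g + (1 - g) := by noncomm_ring
      rw [this]
      exact M.add_mem (hD.1 M _ h _) h') (by
      intro M hM h
      exact hBB M hM (fun h' => h (M.mul_mem_left _ h')) (fun h' => h (hD.1 M _ h' _)))
    refine ⟨fun k => if k = k₀ then (1 - e) * g else ε k, ?_⟩
    intro M hM
    by_cases hgM : g ∈ M
    · left
      refine ⟨hgM, fun k => ?_⟩
      dsimp only
      split_ifs with h
      · exact M.mul_mem_left _ hgM
      · rcases hε M hM with h' | h'
        · exact h'.2 k
        · exact absurd (M.mul_mem_left e hgM) h'.1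
    · right
      refine ⟨hgM, ?_⟩
      have h1g := (hg M hM).resolve_left hgM
      by_cases heM : e ∈ M
      · refine ⟨k₀, Finset.mem_insert_self _ _, hA M hM heM, ?_, ?_⟩
        · dsimp only
          rw [if_pos rfl]
          have : 1 - (1 - e) * g = (1 - g) + e * g := by noncomm_ring
          rw [this]
          exact M.add_mem h1g (hD.1 M _ heM _)
        · intro l hl
          dsimp only
          rw [if_neg hl]
          rcases hε M hM with h' | h'
          · exact h'.2 l
          · exact absurd (hD.1 M _ heM _) h'.1
      · have h1e := (he' M hM).resolve_left heM
        have hegM : e * g ∉ M := fun h => (aux_prime hD M hM h).elim heM hgM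
        obtain ⟨-, k, hks, hak, hk1, hkl⟩ := (hε M hM).resolve_left (fun h => hegM h.1)
        have hkk : k ≠ k₀ := fun h => hk (h ▸ hks)
        refine ⟨k, Finset.mem_insert_of_mem hks, hak, ?_, ?_⟩
        · dsimp only
          rwa [if_neg hkk]
        · intro l hl
          dsimp only
          split_ifs with h
          · exact hD.1 M _ h1e _
          · exact hkl l hl

/-- the pair of vectors -/
theorem aux_pq [IsDomain R] (hD : IsDuoRing R)
    (hFC : ∀ a : R, ∃ e : R, IsUnit (a - e) ∧ ∀ r : R, e * r * (1 - e) ∈ jacobsonRadical R)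
    {m n : ℕ} (A x : Matrix (Fin m) (Fin n) R) (h : ∑ k : Fin m × Fin n, x k.1 k.2 * A k.1 k.2 = 1) :
    ∃ (p : Fin m → R) (q : Fin n → R), IsUnit (∑ i, p i) ∧ IsUnit (∑ j, q j) ∧
      IsUnit (∑ i, ∑ j, p i * A i j * q j) := by
  classical
  obtain ⟨e, he⟩ := aux_part hD hFC (fun k : Fin m × Fin n => x k.1 k.2 * A k.1 k.2)
    Finset.univ 1 (fun M _ => Or.inr (by simp))
    (fun M hM _ => by rw [h]; exact aux_unit_notMem isUnit_one M hM)
  have key : ∀ M : Ideal R, M.IsMaximal → ∃ i₀ j₀, A i₀ j₀ ∉ M ∧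
      1 - e (i₀, j₀) ∈ M ∧ ∀ l, l ≠ (i₀, j₀) → e l ∈ M := by
    intro M hM
    obtain ⟨-, ⟨i, j⟩, -, ha, h1, h2⟩ := (he M hM).resolve_left
      (fun h => aux_unit_notMem isUnit_one M hM h.1)
    exact ⟨i, j, fun h => ha (M.mul_mem_left _ h), h1, h2⟩
  have keyp : ∀ M : Ideal R, (hM : M.IsMaximal) → (hT : M.IsTwoSided) → ∃ i₀ j₀, A i₀ j₀ ∉ M ∧
      (∀ i, Ideal.Quotient.mk M (∑ j, e (i, j)) = if i = i₀ then 1 else 0) ∧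
      (∀ j, Ideal.Quotient.mk M (∑ i, e (i, j)) = if j = j₀ then 1 else 0) := by
    intro M hM hT
    obtain ⟨i₀, j₀, hA, h1, h2⟩ := key M hM
    have hh : ∀ i j, Ideal.Quotient.mk M (e (i, j)) =
        if i = i₀ then (if j = j₀ then 1 else 0) else 0 := by
      intro i j
      split_ifs with ha hb
      · subst ha hb
        rw [← map_one (Ideal.Quotient.mk M), eq_comm, Ideal.Quotient.eq]; exact h1
      · exact Ideal.Quotient.eq_zero_iff_mem.2 (h2 _ (by simp [hb]))
      · exact Ideal.Quotient.eq_zero_iff_mem.2 (h2 _ (by simp [ha]))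
    refine ⟨i₀, j₀, hA, ?_, ?_⟩
    · intro i
      rw [map_sum]
      simp only [hh]
      split_ifs <;> simp
    · intro j
      rw [map_sum]
      simp only [hh]
      simp
  refine ⟨fun i => ∑ j, e (i, j), fun j => ∑ i, e (i, j), ?_, ?_, ?_⟩ <;>
  · apply aux_unit
    intro M hM hmem
    have hT := aux_two hD M
    obtain ⟨i₀, j₀, hA, hp, hq⟩ := keyp M hM hT
    rw [← Ideal.Quotient.eq_zero_iff_mem] at hmem hA
    have hne : (1 : R ⧸ M) ≠ 0 := by
      rw [← map_one (Ideal.Quotient.mk M), Ne, Ideal.Quotient.eq_zero_iff_mem]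
      exact aux_unit_notMem isUnit_one M hM
    rw [map_sum] at hmem
    simp only [map_sum (Ideal.Quotient.mk M) _ Finset.univ, map_mul] at hmem
    simp only [map_sum] at hp hq
    simp [hp, hq, hne, hA] at hmem

/-- gcd of the entries -/
theorem aux_gcd (hB : IsBezoutRing R) {m n : ℕ} (A : Matrix (Fin m) (Fin n) R) :
    ∃ (d : R) (x B : Matrix (Fin m) (Fin n) R), (∀ i j, A i j = B i j * d) ∧
      ∑ k : Fin m × Fin n, x k.1 k.2 * A k.1 k.2 = d := by
  obtain ⟨d, hd⟩ := hB.1 (Ideal.span (Set.range fun k : Fin m × Fin n => A k.1 k.2))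
    (Submodule.fg_span (Set.finite_range _))
  have h1 : ∀ i j, ∃ b, A i j = b * d := by
    intro i j
    have : A i j ∈ Ideal.span {d} := by
      rw [← hd]; exact Ideal.subset_span ⟨(i, j), rfl⟩
    obtain ⟨s, hs⟩ := Ideal.mem_span_singleton'.1 this
    exact ⟨s, hs.symm⟩
  choose B hBB using h1
  have h2 : d ∈ Ideal.span (Set.range fun k : Fin m × Fin n => A k.1 k.2) := by
    rw [hd]; exact Ideal.mem_span_singleton_self d
  obtain ⟨c, hc⟩ := (Submodule.mem_span_range_iff_exists_fun R).1 h2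
  exact ⟨d, fun i j => c (i, j), B, hBB, by simpa using hc⟩

theorem aux_mem_mul (hD : IsDuoRing R) (I : Ideal R) {m n m' n' : ℕ}
    (A : Matrix (Fin m) (Fin n) R) (P : Matrix (Fin m') (Fin m) R) (Q : Matrix (Fin n) (Fin n') R)
    (h : ∀ i j, A i j ∈ I) (i : Fin m') (j : Fin n') : (P * A * Q) i j ∈ I := by
  rw [Matrix.mul_apply]
  refine I.sum_mem fun k _ => hD.1 I _ ?_ _
  rw [Matrix.mul_apply]
  exact I.sum_mem fun k _ => I.mul_mem_left _ (h _ _)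

open Matrix in
theorem aux_step [IsDomain R] (hB : IsBezoutRing R) (hD : IsDuoRing R)
    (hFC : ∀ a : R, ∃ e : R, IsUnit (a - e) ∧ ∀ r : R, e * r * (1 - e) ∈ jacobsonRadical R)
    {m n : ℕ} (A : Matrix (Fin (m+1)) (Fin (n+1)) R) (hA : A ≠ 0) :
    ∃ (P : Matrix (Fin (m+1)) (Fin (m+1)) R) (Q : Matrix (Fin (n+1)) (Fin (n+1)) R), IsUnit P ∧ IsUnit Q ∧ ∃ (d : R) (C : Matrix (Fin m) (Fin n) R),
      P * A * Q = auxExt d C ∧ ∀ i j, C i j ∈ Ideal.span {d} := by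
  obtain ⟨d, x, B, hAB, hx⟩ := aux_gcd hB A
  have hd : d ≠ 0 := by
    rintro rfl
    apply hA; ext i j; simp [hAB]
  have hx1 : ∑ k : Fin (m+1) × Fin (n+1), x k.1 k.2 * B k.1 k.2 = 1 := by
    apply mul_right_cancel₀ hd
    rw [Finset.sum_mul, one_mul]
    simpa only [hAB, mul_assoc] using hx
  obtain ⟨p, q', hp, hq', hw⟩ := aux_pq hD hFC B x hx1
  have hq : ∀ j, ∃ s, q' j * d = d * s := fun j => aux_duo_right hD d (q' j)
  choose q hq using hq
  have hqu : IsUnit (∑ j, q j) := by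
    obtain ⟨u, hu⟩ := hq'
    have h1 : (u : R) * d = d * ∑ j, q j := by
      rw [hu, Finset.sum_mul, Finset.mul_sum]; simp only [hq]
    obtain ⟨z, hz⟩ := aux_duo_right hD d (↑u⁻¹ : R)
    have h2 : z * ∑ j, q j = 1 := by
      apply mul_left_cancel₀ hd
      rw [← mul_assoc, ← hz, mul_assoc, ← h1]; simp
    exact ⟨⟨_, z, mul_eq_one_comm.1 h2, h2⟩, rfl⟩
  obtain ⟨P, hPu, hP⟩ := aux_row p hp
  obtain ⟨Q, hQu, hQ⟩ := aux_col q hqu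
  obtain ⟨w, hw⟩ := hw
  have h00 : (P * A * Q) 0 0 = w * d := by
    rw [hw, Finset.sum_mul]
    simp only [Matrix.mul_apply, Finset.sum_mul]
    rw [Finset.sum_comm]
    refine Finset.sum_congr rfl fun i _ => Finset.sum_congr rfl fun j _ => ?_
    rw [hP, hQ, hAB]
    simp only [mul_assoc, hq]
  have hmem : ∀ i j, (P * A * Q) i j ∈ Ideal.span {(w : R) * d} := by
    apply aux_mem_mul hD
    intro i j
    rw [Ideal.mem_span_singleton']
    exact ⟨B i j * ↑w⁻¹, by rw [hAB]; simp [mul_assoc]⟩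
  generalize hE : P * A * Q = E at h00 hmem
  generalize (w : R) * d = δ at h00 hmem
  have hc : ∀ i : Fin m, ∃ c, c * δ = E i.succ 0 := fun i =>
    Ideal.mem_span_singleton'.1 (hmem _ _)
  have hr : ∀ j : Fin n, ∃ r, E 0 j.succ = δ * r := fun j => by
    obtain ⟨c, hc⟩ := Ideal.mem_span_singleton'.1 (hmem 0 j.succ)
    rw [← hc]
    exact aux_duo_right hD _ _
  choose c hc using hc
  choose r hr using hr
  have hU : IsUnit (1 + vecMulVec (Fin.cons 0 (fun i => - c i) : Fin (m+1) → R)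
      (Pi.single (0 : Fin (m+1)) (1 : R))) := by
    apply aux_rank_one; simp
  have hV : IsUnit (1 + vecMulVec (Pi.single (0 : Fin (n+1)) (1 : R))
      (Fin.cons 0 (fun i => - r i) : Fin (n+1) → R)) := by
    apply aux_rank_one; simp
  generalize hUe : (1 + vecMulVec (Fin.cons 0 (fun i => - c i) : Fin (m+1) → R)
      (Pi.single (0 : Fin (m+1)) (1 : R))) = U at hU
  generalize hVe : (1 + vecMulVec (Pi.single (0 : Fin (n+1)) (1 : R))
      (Fin.cons 0 (fun i => - r i) : Fin (n+1) → R)) = V at hV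
  have hUE0 : ∀ j, (U * E) 0 j = E 0 j := by
    intro j
    rw [← hUe, Matrix.add_mul, Matrix.one_mul]
    simp [Matrix.add_apply, Matrix.mul_apply, vecMulVec_apply, Fin.sum_univ_succ]
  have hUES : ∀ i j, (U * E) (Fin.succ i) j = E i.succ j - c i * E 0 j := by
    intro i j
    rw [← hUe, Matrix.add_mul, Matrix.one_mul]
    simp [Matrix.add_apply, Matrix.mul_apply, vecMulVec_apply, Fin.sum_univ_succ,
      sub_eq_add_neg]
  have hV0 : ∀ (F : Matrix (Fin (m+1)) (Fin (n+1)) R) i, (F * V) i 0 = F i 0 := by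
    intro F j
    rw [← hVe, Matrix.mul_add, Matrix.mul_one]
    simp [Matrix.add_apply, Matrix.mul_apply, vecMulVec_apply, Fin.sum_univ_succ]
  have hVS : ∀ (F : Matrix (Fin (m+1)) (Fin (n+1)) R) i (j : Fin n),
      (F * V) i j.succ = F i j.succ - F i 0 * r j := by
    intro F i j
    rw [← hVe, Matrix.mul_add, Matrix.mul_one]
    simp [Matrix.add_apply, Matrix.mul_apply, vecMulVec_apply, Fin.sum_univ_succ,
      sub_eq_add_neg]
  refine ⟨U * P, Q * V, hU.mul hPu, hQu.mul hV, δ, fun i j => (U * E * V) i.succ j.succ, ?_, ?_⟩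
  · have : U * P * A * (Q * V) = U * E * V := by
      rw [← hE]; simp only [Matrix.mul_assoc]
    rw [this]
    ext i j
    refine Fin.cases ?_ (fun i => ?_) i <;> refine Fin.cases ?_ (fun j => ?_) j
    · rw [hV0, hUE0, h00]; rfl
    · rw [hVS, hUE0, hUE0, h00, hr, sub_self]; rfl
    · rw [hV0, hUES, h00, hc, sub_self]; rfl
    · rfl
  · intro i j
    exact aux_mem_mul hD _ E U V hmem _ _

theorem aux_main [IsDomain R] (hB : IsBezoutRing R) (hD : IsDuoRing R)
    (hFC : ∀ a : R, ∃ e : R, IsUnit (a - e) ∧ ∀ r : R, e * r * (1 - e) ∈ jacobsonRadical R)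
    (m : ℕ) : ∀ (n : ℕ) (A : Matrix (Fin m) (Fin n) R), AdmitsDiagonalReduction A := by
  induction m with
  | zero =>
    intro n A
    exact ⟨1, 1, isUnit_one, isUnit_one, fun i => i.elim0, fun i => i.elim0⟩
  | succ m ih =>
    intro n A
    cases n with
    | zero => exact ⟨1, 1, isUnit_one, isUnit_one, fun _ i => i.elim0, fun _ i => i.elim0⟩
    | succ n =>
    by_cases hA : A = 0
    · subst hA
      exact ⟨1, 1, isUnit_one, isUnit_one, by simp, by simp⟩
    obtain ⟨P, Q, hP, hQ, d, C, hC, hCd⟩ := aux_step hB hD hFC A hA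
    obtain ⟨P', Q', hP', hQ', h1, h2⟩ := ih n C
    have hmem := aux_mem_mul hD _ C P' Q' hCd
    have hprod : (auxExt 1 P' * P) * A * (Q * auxExt 1 Q') = auxExt d (P' * C * Q') := by
      have : (auxExt 1 P' * P) * A * (Q * auxExt 1 Q')
          = auxExt 1 P' * (P * A * Q) * auxExt 1 Q' := by simp only [Matrix.mul_assoc]
      rw [this, hC, auxExt_mul, auxExt_mul]; simp
    refine ⟨auxExt 1 P' * P, Q * auxExt 1 Q', (auxExt_isUnit hP').mul hP,
      hQ.mul (auxExt_isUnit hQ'), ?_, ?_⟩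
    · rw [hprod]
      intro i j
      refine Fin.cases ?_ (fun i => ?_) i <;> refine Fin.cases ?_ (fun j => ?_) j
      · simp
      · simp
      · simp
      · intro h; exact h1 i j (by simpa using h)
    · rw [hprod]
      intro i j i' j' hij hij' hi x y
      obtain ⟨i', rfl⟩ := Fin.exists_succ_eq.2 (show i' ≠ 0 by rintro rfl; simp at hi)
      obtain ⟨j', rfl⟩ := Fin.exists_succ_eq.2
        (show j' ≠ 0 by rintro rfl; simp at hij')
      rw [auxExt_ss]
      revert hij hi
      refine Fin.cases ?_ (fun i => ?_) i <;> refine Fin.cases ?_ (fun j => ?_) j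
      · intro _ _
        rw [auxExt_zz]
        have : x * (P' * C * Q') i' j' * y ∈ Ideal.span {d} :=
          hD.1 _ _ (Ideal.mul_mem_left _ _ (hmem i' j')) _
        obtain ⟨s, hs⟩ := Ideal.mem_span_singleton'.1 this
        refine ⟨?_, s, hs.symm⟩
        rw [← hs]; exact aux_duo_right hD _ _
      · simp
      · simp
      · intro hij hi
        rw [auxExt_ss]
        exact h2 i j i' j' (by simpa using hij) (by simpa using hij') (by simpa using hi) x y
end

/-- Every feckly clean Bézout duo-domain is an elementary divisor ring. -/
theorem stmt12 (R : Type*) [Ring R] [IsDomain R]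
    (hB : IsBezoutRing R) (hD : IsDuoRing R)
    (hFC : ∀ a : R, ∃ e : R, IsUnit (a - e) ∧ ∀ r : R, e * r * (1 - e) ∈ jacobsonRadical R) :
    ElementaryDivisorRing R := by
  intro m n A
  exact aux_main hB hD hFC m n A
end

section
/- Every Zabavsky duo-domain is an elementary divisor ring; that is, if R is a Bézout duo-domain such that whenever aR + bR = R there exists y ∈ R with a + by feckly adequate, then R is an elementary divisor ring. -/
namespace ZabAux

section Embed
variable {R : Type*} [Ring R] {ι κ : Type*} [Fintype ι] [DecidableEq ι] [Fintype κ] [DecidableEq κ]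

/-- Embed a matrix along an injective map of index sets, identity elsewhere. -/
def emb (f : κ → ι) (Q : Matrix κ κ R) : Matrix ι ι R :=
  1 + (1 : Matrix ι ι R).submatrix id f * (Q - 1) * (1 : Matrix ι ι R).submatrix f id

lemma emb_one (f : κ → ι) : emb f (1 : Matrix κ κ R) = 1 := by simp [emb]

lemma emb_mul (f : κ → ι) (hf : Function.Injective f) (Q N : Matrix κ κ R) :
    emb f (Q * N) = emb f Q * emb f N := by
  have h : (1 : Matrix ι ι R).submatrix f id * (1 : Matrix ι ι R).submatrix id f = 1 := by
    have h0 := Matrix.submatrix_mul_equiv (1 : Matrix ι ι R) (1 : Matrix ι ι R) f (Equiv.refl ι) f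
    rw [Matrix.one_mul] at h0
    refine Eq.trans h0 ?_
    exact Matrix.submatrix_one f hf
  unfold emb
  generalize (1 : Matrix ι ι R).submatrix f id = D at *
  generalize (1 : Matrix ι ι R).submatrix id f = C at *
  have e : C * (Q - 1) * D * (C * (N - 1) * D) = C * ((Q - 1) * (N - 1)) * D := by
    calc _ = C * (Q - 1) * (D * C) * (N - 1) * D := by simp only [Matrix.mul_assoc]
      _ = _ := by rw [h]; simp only [Matrix.mul_assoc, Matrix.one_mul]
  rw [add_mul, mul_add, mul_add, e]
  have : Q * N - 1 = (Q - 1) + (N - 1) + (Q - 1) * (N - 1) := by noncomm_ring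
  rw [this]
  simp only [Matrix.mul_add, Matrix.add_mul, one_mul, mul_one]
  abel

lemma emb_isUnit (f : κ → ι) (hf : Function.Injective f) {Q : Matrix κ κ R} (hQ : IsUnit Q) :
    IsUnit (emb f Q) := by
  obtain ⟨u, rfl⟩ := hQ
  refine ⟨⟨emb f u, emb f (u⁻¹ : (Matrix κ κ R)ˣ), ?_, ?_⟩, rfl⟩
  · rw [← emb_mul f hf]; simp [emb_one]
  · rw [← emb_mul f hf]; simp [emb_one]

lemma emb_apply (f : κ → ι) (hf : Function.Injective f) (Q : Matrix κ κ R) (a b : κ) :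
    emb f Q (f a) (f b) = Q a b := by
  simp [emb, Matrix.mul_apply, Matrix.one_apply, hf.eq_iff, Matrix.sub_apply]

lemma emb_apply_left (f : κ → ι) (Q : Matrix κ κ R) (k l : ι) (hk : ∀ a, f a ≠ k) :
    emb f Q k l = (1 : Matrix ι ι R) k l := by
  simp [emb, Matrix.mul_apply, Matrix.one_apply, fun a => (hk a).symm]

lemma emb_apply_right (f : κ → ι) (Q : Matrix κ κ R) (k l : ι) (hk : ∀ a, f a ≠ l) :
    emb f Q k l = (1 : Matrix ι ι R) k l := by
  simp [emb, Matrix.mul_apply, Matrix.one_apply, hk]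

lemma vecMul_emb (f : κ → ι) (hf : Function.Injective f) (Q : Matrix κ κ R) (v : ι → R) (b : κ) :
    Matrix.vecMul v (emb f Q) (f b) = Matrix.vecMul (v ∘ f) Q b := by
  classical
  simp only [Matrix.vecMul, dotProduct]
  rw [← Finset.sum_subset (Finset.subset_univ (Finset.univ.image f))]
  · rw [Finset.sum_image (fun x _ y _ h => hf h)]
    simp [emb_apply f hf]
  · intro k _ hk
    have hk' : ∀ a, f a ≠ k := by simpa using hk
    rw [emb_apply_left f Q _ _ hk', Matrix.one_apply_ne (hk' b).symm, mul_zero]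

lemma vecMul_emb_ne (f : κ → ι) (Q : Matrix κ κ R) (v : ι → R) (l : ι)
    (hl : ∀ a, f a ≠ l) : Matrix.vecMul v (emb f Q) l = v l := by
  simp only [Matrix.vecMul, dotProduct]
  simp [emb_apply_right f Q _ l hl, Matrix.one_apply]
end Embed

section Main
variable {R : Type*} [Ring R]

/-- Elementary form of the Bezout duo hypotheses. -/
structure BD (R : Type*) [Ring R] : Prop where
  toL : ∀ a r : R, ∃ r', a * r = r' * a
  toR : ∀ a r : R, ∃ r', r * a = a * r'
  two : ∀ I : Ideal R, ∀ a ∈ I, ∀ r : R, a * r ∈ I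
  bez : ∀ I : Ideal R, I.FG → ∃ d : R, I = Ideal.span {d}

lemma BD.mk' (hB : IsBezoutRing R) (hD : IsDuoRing R) : BD R where
  toL a r := by
    have := hD.1 (Ideal.span {a}) a (Ideal.mem_span_singleton_self a) r
    obtain ⟨r', h⟩ := Ideal.mem_span_singleton'.1 this
    exact ⟨r', h.symm⟩
  toR a r := by
    have := hD.2 (Submodule.span Rᵐᵒᵖ {a}) a (Submodule.mem_span_singleton_self a) r
    obtain ⟨r', h⟩ := Submodule.mem_span_singleton.1 this
    exact ⟨r'.unop, h.symm⟩
  two := hD.1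
  bez := hB.1

lemma BD.gcd (h : BD R) (a b : R) : ∃ d x y a' b' : R, d = a * x + b * y ∧ a = d * a' ∧ b = d * b' := by
  obtain ⟨d, hd⟩ := h.bez (Ideal.span {a, b}) (Submodule.fg_span (Set.toFinite _))
  have h1 : d ∈ Ideal.span {a, b} := hd ▸ Ideal.mem_span_singleton_self d
  obtain ⟨x, y, hxy⟩ := Ideal.mem_span_pair.1 h1
  have ha : a ∈ Ideal.span {d} := hd ▸ Ideal.subset_span (by simp)
  have hb : b ∈ Ideal.span {d} := hd ▸ Ideal.subset_span (by simp)
  obtain ⟨a', ha⟩ := Ideal.mem_span_singleton'.1 ha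
  obtain ⟨b', hb⟩ := Ideal.mem_span_singleton'.1 hb
  obtain ⟨x', hx⟩ := h.toR a x
  obtain ⟨y', hy⟩ := h.toR b y
  obtain ⟨a'', ha'⟩ := h.toR d a'
  obtain ⟨b'', hb'⟩ := h.toR d b'
  exact ⟨d, x', y', a'', b'', by rw [← hx, ← hy, hxy], by rw [← ha', ha], by rw [← hb', hb]⟩

lemma BD.prime (h : BD R) {M : Ideal R} (hM : M.IsMaximal) {x y : R} (hxy : x * y ∈ M) :
    x ∈ M ∨ y ∈ M := by
  by_contra! hc
  obtain ⟨hx, hy⟩ := hc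
  have : M ⊔ Ideal.span {y} = ⊤ := by
    apply hM.1.2
    refine lt_of_le_of_ne le_sup_left fun he => hy ?_
    rw [he]; exact Ideal.mem_sup_right (Ideal.mem_span_singleton_self y)
  have h1 : (1 : R) ∈ M ⊔ Ideal.span {y} := by rw [this]; trivial
  obtain ⟨m, hm, z, hz, e⟩ := Submodule.mem_sup.1 h1
  obtain ⟨r, rfl⟩ := Ideal.mem_span_singleton'.1 hz
  obtain ⟨r', hr⟩ := h.toR y r
  apply hx
  have : x = x * m + x * y * r' := by
    rw [mul_assoc, ← hr, ← mul_add, e, mul_one]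
  rw [this]
  exact M.add_mem (M.mul_mem_left _ hm) (h.two M _ hxy _)

lemma exists_comb {a b : R} (hab : ∀ M : Ideal R, M.IsMaximal → ¬ (a ∈ M ∧ b ∈ M)) :
    ∃ x y, x * a + y * b = 1 := by
  apply Ideal.mem_span_pair.1
  rw [← Ideal.eq_top_iff_one]
  by_contra hne
  obtain ⟨M, hM, hle⟩ := Ideal.exists_le_maximal _ hne
  exact hab M hM ⟨hle (Ideal.subset_span (by simp)), hle (Ideal.subset_span (by simp))⟩

lemma BD.exists_combR (h : BD R) {a b : R}
    (hab : ∀ M : Ideal R, M.IsMaximal → ¬ (a ∈ M ∧ b ∈ M)) : ∃ x y, a * x + b * y = 1 := by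
  obtain ⟨x, y, e⟩ := exists_comb hab
  obtain ⟨x', hx⟩ := h.toR a x
  obtain ⟨y', hy⟩ := h.toR b y
  exact ⟨x', y', by rw [← hx, ← hy, e]⟩

lemma not_unit {M : Ideal R} (hM : M.IsMaximal) {x : R} (hx : x ∈ M) : ¬ IsUnit x := by
  intro hu
  exact hM.ne_top (Ideal.eq_top_of_isUnit_mem _ hx hu)

/-- The scalar core of the argument. -/
lemma BD.scalar (h : BD R)
    (hZ : ∀ a b : R, (∃ x y : R, a * x + b * y = 1) →
      ∃ y : R, IsFecklyAdequateElement (a + b * y))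
    (a b : R) (C : Ideal R) (hC : C.FG)
    (hu : ∀ M : Ideal R, M.IsMaximal → ¬ (a ∈ M ∧ b ∈ M ∧ C ≤ M)) :
    ∃ p q : R, ∀ M : Ideal R, M.IsMaximal → ¬ (p * a + q * b ∈ M ∧ (q ∈ M ∨ C ≤ M)) := by
  have fgs : ∀ z : R, (Ideal.span {z} ⊔ C).FG := fun z =>
    Submodule.FG.sup ⟨{z}, by simp⟩ hC
  obtain ⟨d, hd⟩ := h.bez _ (fgs a)
  have hdm : d ∈ Ideal.span {a} ⊔ C := hd ▸ Ideal.mem_span_singleton_self d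
  have had : Ideal.span {a} ≤ Ideal.span {d} := hd ▸ le_sup_left
  have hCd : C ≤ Ideal.span {d} := hd ▸ le_sup_right
  obtain ⟨y, hy⟩ := hZ b d (h.exists_combR (by
    rintro M hM ⟨h1, h2⟩
    have hle : Ideal.span {d} ≤ M := by
      rw [Ideal.span_singleton_le_iff_mem]; exact h2
    exact hu M hM ⟨hle (had (Ideal.mem_span_singleton_self a)), h1, hCd.trans hle⟩))
  obtain ⟨r, s, hJ, ⟨x1, y1, hra⟩, hs⟩ := hy a
  have one_not : ∀ M : Ideal R, M.IsMaximal → (1 : R) ∉ M := fun M hM h1 =>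
    hM.ne_top ((Ideal.eq_top_iff_one _).2 h1)
  have hJM : ∀ M : Ideal R, M.IsMaximal → b + d * y - r * s ∈ M := fun M hM =>
    (Submodule.mem_sInf.1 hJ) M ⟨bot_le, hM⟩
  have f1 : ∀ M : Ideal R, M.IsMaximal → ¬ (r ∈ M ∧ a ∈ M) := by
    rintro M hM ⟨h1, h2⟩
    apply one_not M hM
    rw [← hra]
    exact M.add_mem (h.two M _ h1 _) (h.two M _ h2 _)
  have f2 : ∀ s' u : R, s = u * s' → (∀ M : Ideal R, M.IsMaximal → ¬ (s' ∈ M ∧ a ∈ M)) →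
      IsUnit s' := by
    intro s' u e hco
    by_contra hn
    obtain ⟨u', hu'⟩ := h.toR s' u
    exact hs s' hn ⟨u', by rw [e, hu']⟩ (h.exists_combR hco)
  have f3 : ∀ M : Ideal R, M.IsMaximal → ¬ (r ∈ M ∧ s ∈ M) := by
    obtain ⟨g, hg⟩ := h.bez (Ideal.span {r, s}) (Submodule.fg_span (Set.toFinite _))
    have hr : r ∈ Ideal.span {g} := hg ▸ Ideal.subset_span (by simp)
    have hs' : s ∈ Ideal.span {g} := hg ▸ Ideal.subset_span (by simp)
    obtain ⟨u, hu'⟩ := Ideal.mem_span_singleton'.1 hs'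
    obtain ⟨w, hw⟩ := Ideal.mem_span_singleton'.1 hr
    have hgu := f2 g u hu'.symm (by
      rintro M hM ⟨h1, h2⟩
      exact f1 M hM ⟨hw ▸ M.mul_mem_left w h1, h2⟩)
    rintro M hM ⟨h1, h2⟩
    have : Ideal.span {r, s} ≤ M := by
      rw [Ideal.span_le]; rintro z (rfl | rfl) <;> assumption
    exact not_unit hM (this (hg ▸ Ideal.mem_span_singleton_self g)) hgu
  have f4 : ∀ M : Ideal R, M.IsMaximal → ¬ (s ∈ M ∧ C ≤ M) := by
    obtain ⟨g, hg⟩ := h.bez _ (fgs s)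
    have hs' : s ∈ Ideal.span {g} :=
      hg ▸ Ideal.mem_sup_left (Ideal.mem_span_singleton_self s)
    have hCg : C ≤ Ideal.span {g} := hg ▸ le_sup_right
    obtain ⟨u, hu'⟩ := Ideal.mem_span_singleton'.1 hs'
    have hgu := f2 g u hu'.symm (by
      rintro M hM ⟨h1, h2⟩
      have hle : Ideal.span {g} ≤ M := by
        rw [Ideal.span_singleton_le_iff_mem]; exact h1
      have hCM := hCg.trans hle
      have hdM : d ∈ M := by
        have : Ideal.span {a} ⊔ C ≤ M :=
          sup_le (by rw [Ideal.span_singleton_le_iff_mem]; exact h2) hCM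
        exact this hdm
      have hsM : s ∈ M := hle hs'
      refine hu M hM ⟨h2, ?_, hCM⟩
      have e : b = (b + d * y - r * s) + r * s - d * y := by abel
      rw [e]
      exact M.sub_mem (M.add_mem (hJM M hM) (M.mul_mem_left _ hsM)) (h.two M _ hdM _))
    rintro M hM ⟨h1, h2⟩
    have : Ideal.span {s} ⊔ C ≤ M :=
      sup_le (by rw [Ideal.span_singleton_le_iff_mem]; exact h1) h2
    exact not_unit hM (this (hg ▸ Ideal.mem_span_singleton_self g)) hgu
  obtain ⟨q, y2, hq⟩ := exists_comb (a := r) (b := s * a) (by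
    rintro M hM ⟨h1, h2⟩
    rcases h.prime hM h2 with h3 | h3
    · exact f3 M hM ⟨h1, h3⟩
    · exact f1 M hM ⟨h1, h3⟩)
  obtain ⟨t, ht⟩ := h.toL a s
  have hdy : d * y ∈ Ideal.span {a} ⊔ C := h.two _ _ hdm _
  obtain ⟨z, hz, c, hc, hzc⟩ := Submodule.mem_sup.1 hdy
  obtain ⟨g, rfl⟩ := Ideal.mem_span_singleton'.1 hz
  refine ⟨y2 * s * t + q * g, q, ?_⟩
  rintro M hM ⟨h1, h2⟩
  have hqc : q * c ∈ M := by
    rcases h2 with h2 | h2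
    · exact h.two M _ h2 _
    · exact M.mul_mem_left _ (h2 hc)
  have hsM : s ∈ M := by
    have e : s = ((y2 * s * t + q * g) * a + q * b) + q * c - q * (b + d * y - r * s) := by
      rw [← hzc]
      have e1 : s = q * r * s + y2 * s * t * a := by
        calc s = (q * r + y2 * (s * a)) * s := by rw [hq, one_mul]
          _ = q * r * s + y2 * s * (a * s) := by noncomm_ring
          _ = _ := by rw [ht]; noncomm_ring
      calc s = q * r * s + y2 * s * t * a := e1
        _ = _ := by noncomm_ring
    rw [e]
    exact M.sub_mem (M.add_mem h1 hqc) (M.mul_mem_left _ (hJM M hM))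
  rcases h2 with h2 | h2
  · apply one_not M hM
    rw [← hq]
    exact M.add_mem (h.two M _ h2 _) (M.mul_mem_left _ (h.two M _ hsM _))
  · exact f4 M hM ⟨hsM, h2⟩

variable [IsDomain R]

lemma BD.hermite2 (h : BD R) (v : Fin 2 → R) :
    ∃ Q : Matrix (Fin 2) (Fin 2) R, IsUnit Q ∧ Matrix.vecMul v Q 1 = 0 := by
  by_cases hb0 : v 1 = 0
  · exact ⟨1, isUnit_one, by simpa using hb0⟩
  obtain ⟨d, x, y, a', b', hd, ha, hb⟩ := h.gcd (v 0) (v 1)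
  have hd0 : d ≠ 0 := by rintro rfl; simp at hb; exact hb0 hb
  have hb'0 : b' ≠ 0 := by rintro rfl; simp at hb; exact hb0 hb
  have h1 : a' * x + b' * y = 1 := by
    apply mul_left_cancel₀ hd0
    rw [mul_add, ← mul_assoc, ← mul_assoc, ← ha, ← hb, ← hd, mul_one]
  obtain ⟨z, k, l, e, f, hz, he, hf⟩ := h.gcd (1 - x * a') (-(x * b'))
  have hz0 : z ≠ 0 := by
    rintro rfl
    rw [zero_mul] at he hf
    have hx : x = 0 := by
      have := neg_eq_zero.1 hf
      rcases mul_eq_zero.1 this with h | h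
      · exact h
      · exact absurd h hb'0
    rw [hx] at he; simp at he
  -- w is the second coordinate of the kernel generator
  let w : R := (-(y * a')) * k + (1 - y * b') * l
  have hk1 : a' * (1 - x * a') + b' * (-(y * a')) = 0 := by
    calc _ = a' - (a' * x + b' * y) * a' := by noncomm_ring
      _ = 0 := by rw [h1]; simp
  have hk2 : a' * (-(x * b')) + b' * (1 - y * b') = 0 := by
    calc _ = b' - (a' * x + b' * y) * b' := by noncomm_ring
      _ = 0 := by rw [h1]; simp
  have hker : a' * z + b' * w = 0 := by
    calc _ = (a' * (1 - x * a') + b' * (-(y * a'))) * k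
          + (a' * (-(x * b')) + b' * (1 - y * b')) * l := by rw [hz]; simp only [w]; noncomm_ring
      _ = 0 := by rw [hk1, hk2]; simp
  have he2 : w * e = -(y * a') := by
    apply mul_left_cancel₀ hb'0
    calc b' * (w * e) = (a' * z + b' * w) * e - a' * (z * e) := by noncomm_ring
      _ = - (a' * (1 - x * a')) := by rw [hker, ← he]; simp
      _ = b' * -(y * a') := by rw [eq_neg_of_add_eq_zero_left hk1]; simp
  have hf2 : w * f = 1 - y * b' := by
    apply mul_left_cancel₀ hb'0
    calc b' * (w * f) = (a' * z + b' * w) * f - a' * (z * f) := by noncomm_ring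
      _ = - (a' * (-(x * b'))) := by rw [hker, ← hf]; simp
      _ = b' * (1 - y * b') := by rw [eq_neg_of_add_eq_zero_left hk2]; simp
  have g1 : e * x + f * y = 0 := by
    apply mul_left_cancel₀ hz0
    calc z * (e * x + f * y) = (z * e) * x + (z * f) * y := by noncomm_ring
      _ = x - x * (a' * x + b' * y) := by rw [← he, ← hf]; noncomm_ring
      _ = z * 0 := by rw [h1]; simp
  have g2 : e * z + f * w = 1 := by
    apply mul_left_cancel₀ hz0
    calc z * (e * z + f * w) = (z * e) * z + (z * f) * w := by noncomm_ring
      _ = z - x * (a' * z + b' * w) := by rw [← he, ← hf]; noncomm_ring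
      _ = z * 1 := by rw [hker]; simp
  refine ⟨!![x, z; y, w], ⟨⟨!![x, z; y, w], !![a', b'; e, f], ?_, ?_⟩, rfl⟩, ?_⟩
  · rw [Matrix.mul_fin_two, Matrix.one_fin_two, ← he, ← hf, he2, hf2]; simp
  · rw [Matrix.mul_fin_two, Matrix.one_fin_two, h1, hker, g1, g2]
  · simp only [Matrix.vecMul, dotProduct, Fin.sum_univ_two]
    simp only [Matrix.of_apply, Matrix.cons_val', Matrix.cons_val_zero, Matrix.cons_val_one,
      Matrix.cons_val_fin_one]
    rw [ha, hb, mul_assoc, mul_assoc, ← mul_add, hker, mul_zero]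

lemma BD.hermite (h : BD R) (n : ℕ) (v : Fin (n + 1) → R) :
    ∃ Q : Matrix (Fin (n + 1)) (Fin (n + 1)) R, IsUnit Q ∧
      ∀ j, j ≠ 0 → Matrix.vecMul v Q j = 0 := by
  induction n with
  | zero =>
    refine ⟨1, isUnit_one, fun j hj => absurd (Fin.ext (by omega)) hj⟩
  | succ n ih =>
    obtain ⟨Q1, hQ1, h1⟩ := ih (v ∘ Fin.succ)
    have s_inj := Fin.succ_injective (n + 1)
    set v1 := Matrix.vecMul v (emb Fin.succ Q1) with hv1
    have f_inj : Function.Injective (![0, 1] : Fin 2 → Fin (n + 2)) := by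
      intro a b hab
      fin_cases a <;> fin_cases b <;> simp_all
    obtain ⟨Q2, hQ2, h2⟩ := h.hermite2 (v1 ∘ ![0, 1])
    refine ⟨emb Fin.succ Q1 * emb ![0, 1] Q2,
      (emb_isUnit _ s_inj hQ1).mul (emb_isUnit _ f_inj hQ2), ?_⟩
    intro j hj
    rw [← Matrix.vecMul_vecMul, ← hv1]
    by_cases hj1 : j = 1
    · subst hj1
      have := vecMul_emb ![0, 1] f_inj Q2 v1 1
      simp only [Matrix.cons_val_one, Matrix.cons_val_fin_one] at this
      rw [this, h2]
    · rw [vecMul_emb_ne]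
      · obtain ⟨k, rfl⟩ := Fin.exists_succ_eq.2 hj
        rw [hv1, vecMul_emb _ s_inj]
        apply h1
        rintro rfl
        exact hj1 rfl
      · intro a
        fin_cases a
        · simpa using Ne.symm hj
        · simpa using Ne.symm hj1

/-- Ideal of a vector. -/
def I {n : ℕ} (v : Fin n → R) : Ideal R := Ideal.span (Set.range v)

lemma mem_I {n : ℕ} (v : Fin n → R) (i : Fin n) : v i ∈ I v := Ideal.subset_span ⟨i, rfl⟩

lemma I_le {n : ℕ} {v : Fin n → R} {J : Ideal R} : I v ≤ J ↔ ∀ i, v i ∈ J := by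
  unfold I
  rw [Ideal.span_le]
  exact Set.range_subset_iff

lemma I_fg {n : ℕ} (v : Fin n → R) : (I v).FG := Submodule.fg_span (Set.finite_range v)

lemma BD.I_vecMul_le (h : BD R) {n k : ℕ} (v : Fin n → R) (Q : Matrix (Fin n) (Fin k) R) :
    I (Matrix.vecMul v Q) ≤ I v := by
  rw [I_le]
  intro i
  rw [Matrix.vecMul, dotProduct]
  exact Ideal.sum_mem _ fun j _ => h.two _ _ (mem_I v j) _

lemma BD.I_vecMul (h : BD R) {n : ℕ} (v : Fin n → R) {Q : Matrix (Fin n) (Fin n) R}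
    (hQ : IsUnit Q) : I (Matrix.vecMul v Q) = I v := by
  obtain ⟨u, rfl⟩ := hQ
  apply le_antisymm (h.I_vecMul_le _ _)
  have := h.I_vecMul_le (Matrix.vecMul v u.val) (u⁻¹).val
  rwa [Matrix.vecMul_vecMul, Units.mul_inv, Matrix.vecMul_one] at this

lemma BD.two_rows_uni (h : BD R)
    (hZ : ∀ a b : R, (∃ x y : R, a * x + b * y = 1) →
      ∃ y : R, IsFecklyAdequateElement (a + b * y))
    {n : ℕ} (v w : Fin (n + 1) → R) (hvw : I v ⊔ I w = ⊤) :
    ∃ p q : R, I (p • v + q • w) = ⊤ := by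
  obtain ⟨Q, hQ, hv⟩ := h.hermite n v
  obtain ⟨p, q, hpq⟩ := h.scalar hZ (Matrix.vecMul v Q 0) (Matrix.vecMul w Q 0)
    (I (fun i : Fin n => Matrix.vecMul w Q i.succ)) (I_fg _) (by
      rintro M hM ⟨h1, h2, h3⟩
      apply hM.ne_top
      rw [eq_top_iff, ← hvw, ← h.I_vecMul v hQ, ← h.I_vecMul w hQ]
      refine sup_le (I_le.2 fun i => ?_) (I_le.2 fun i => ?_)
      · by_cases hi : i = 0
        · rw [hi]; exact h1
        · rw [hv i hi]; exact M.zero_mem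
      · refine Fin.cases h2 (fun i => ?_) i
        exact I_le.1 h3 i)
  refine ⟨p, q, ?_⟩
  rw [← h.I_vecMul _ hQ]
  by_contra hne
  obtain ⟨M, hM, hle⟩ := Ideal.exists_le_maximal _ hne
  rw [I_le] at hle
  simp only [Matrix.add_vecMul, Matrix.smul_vecMul, Pi.add_apply, Pi.smul_apply, smul_eq_mul] at hle
  refine hpq M hM ⟨hle 0, ?_⟩
  by_contra! hc
  obtain ⟨hq, hC⟩ := hc
  apply hC
  rw [I_le]
  intro i
  have := hle i.succ
  rw [hv _ (Fin.succ_ne_zero i), mul_zero, zero_add] at this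
  exact (h.prime hM this).resolve_left hq

lemma BD.mul_mem_I (h : BD R) {n : ℕ} (d : R) (u : Fin n → R) (x : R) (hx : x ∈ I u) :
    d * x ∈ I (fun i => d * u i) := by
  unfold I at hx
  induction hx using Submodule.span_induction with
  | mem x hx => obtain ⟨i, rfl⟩ := hx; exact mem_I (fun i => d * u i) i
  | zero => simp
  | add x y _ _ hx hy => rw [mul_add]; exact Ideal.add_mem _ hx hy
  | smul r x _ hx =>
    obtain ⟨r', hr⟩ := h.toL d r
    rw [smul_eq_mul, ← mul_assoc, hr, mul_assoc]
    exact Ideal.mul_mem_left _ _ hx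

lemma BD.two_rows (h : BD R)
    (hZ : ∀ a b : R, (∃ x y : R, a * x + b * y = 1) →
      ∃ y : R, IsFecklyAdequateElement (a + b * y))
    {n : ℕ} (v w : Fin (n + 1) → R) :
    ∃ p q : R, I v ⊔ I w ≤ I (p • v + q • w) := by
  obtain ⟨d, hd⟩ := h.bez (I v ⊔ I w) (Submodule.FG.sup (I_fg _) (I_fg _))
  rw [hd]
  by_cases hd0 : d = 0
  · exact ⟨0, 0, by simp [hd0]⟩
  have hdm : d ∈ I v ⊔ I w := hd ▸ Ideal.mem_span_singleton_self d
  have key : ∀ x : R, x ∈ I v ⊔ I w → ∃ x', x = d * x' := by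
    intro x hx
    rw [hd] at hx
    obtain ⟨y, rfl⟩ := Ideal.mem_span_singleton'.1 hx
    exact h.toR d y
  choose v' hv' using fun i => key (v i) (Ideal.mem_sup_left (mem_I v i))
  choose w' hw' using fun i => key (w i) (Ideal.mem_sup_right (mem_I w i))
  obtain ⟨g, hg⟩ := h.bez (I v' ⊔ I w') (Submodule.FG.sup (I_fg _) (I_fg _))
  have hle : I v ⊔ I w ≤ Ideal.span {d * g} := by
    have aux : ∀ x, x ∈ I v' ⊔ I w' → d * x ∈ Ideal.span {d * g} := by
      intro x hx
      rw [hg] at hx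
      obtain ⟨y, rfl⟩ := Ideal.mem_span_singleton'.1 hx
      obtain ⟨y', hy⟩ := h.toL d y
      rw [← mul_assoc, hy, mul_assoc]
      exact Ideal.mul_mem_left _ _ (Ideal.mem_span_singleton_self _)
    refine sup_le (I_le.2 fun i => ?_) (I_le.2 fun i => ?_)
    · rw [hv']; exact aux _ (Ideal.mem_sup_left (mem_I v' i))
    · rw [hw']; exact aux _ (Ideal.mem_sup_right (mem_I w' i))
  have htop : I v' ⊔ I w' = ⊤ := by
    obtain ⟨t, ht⟩ := Ideal.mem_span_singleton'.1 (hle hdm)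
    obtain ⟨t', ht'⟩ := h.toR d t
    rw [hg, Ideal.eq_top_iff_one, Ideal.mem_span_singleton']
    refine ⟨t', mul_left_cancel₀ hd0 ?_⟩
    rw [← mul_assoc, ← ht', mul_one, mul_assoc, ht]
  obtain ⟨p, q, hpq⟩ := h.two_rows_uni hZ v' w' htop
  obtain ⟨p', hp⟩ := h.toL d p
  obtain ⟨q', hq⟩ := h.toL d q
  refine ⟨p', q', ?_⟩
  rw [Ideal.span_singleton_le_iff_mem]
  have := h.mul_mem_I d (p • v' + q • w') 1 (by rw [hpq]; trivial)
  rw [mul_one] at this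
  convert this using 2
  funext i
  simp only [Pi.add_apply, Pi.smul_apply, smul_eq_mul]
  rw [hv', hw', ← mul_assoc, ← mul_assoc, ← hp, ← hq]
  noncomm_ring

lemma BD.rows (h : BD R)
    (hZ : ∀ a b : R, (∃ x y : R, a * x + b * y = 1) →
      ∃ y : R, IsFecklyAdequateElement (a + b * y))
    {m n : ℕ} (A : Matrix (Fin m) (Fin (n + 1)) R) :
    ∃ p : Fin m → R, ∀ i j, A i j ∈ I (Matrix.vecMul p A) := by
  induction m with
  | zero => exact ⟨0, fun i => i.elim0⟩
  | succ m ih =>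
    obtain ⟨p, hp⟩ := ih (A.submatrix Fin.succ id)
    obtain ⟨x, y, hxy⟩ := h.two_rows hZ (A 0) (Matrix.vecMul p (A.submatrix Fin.succ id))
    refine ⟨Fin.cons x (y • p), fun i j => ?_⟩
    have e : Matrix.vecMul (Fin.cons x (y • p) : Fin (m + 1) → R) A =
        x • A 0 + y • Matrix.vecMul p (A.submatrix Fin.succ id) := by
      funext k
      simp [Matrix.vecMul, dotProduct, Fin.sum_univ_succ, Finset.mul_sum, mul_assoc]
    rw [e]
    apply hxy
    refine Fin.cases ?_ (fun i => ?_) i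
    · exact Ideal.mem_sup_left (mem_I (A 0) j)
    · exact Ideal.mem_sup_right (hp i j)

lemma BD.mul_mem (h : BD R) {m n k l : ℕ} {J : Ideal R} {A : Matrix (Fin m) (Fin n) R}
    (hA : ∀ i j, A i j ∈ J) (P : Matrix (Fin k) (Fin m) R) (Q : Matrix (Fin n) (Fin l) R) :
    ∀ i j, (P * A * Q) i j ∈ J := by
  intro i j
  rw [Matrix.mul_apply]
  refine Ideal.sum_mem _ fun x _ => h.two _ _ ?_ _
  rw [Matrix.mul_apply]
  exact Ideal.sum_mem _ fun y _ => Ideal.mul_mem_left _ _ (hA _ _)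

lemma BD.step (h : BD R)
    (hZ : ∀ a b : R, (∃ x y : R, a * x + b * y = 1) →
      ∃ y : R, IsFecklyAdequateElement (a + b * y))
    {m n : ℕ} (A : Matrix (Fin (m + 1)) (Fin (n + 1)) R) :
    ∃ (P : Matrix (Fin (m + 1)) (Fin (m + 1)) R) (Q : Matrix (Fin (n + 1)) (Fin (n + 1)) R),
      IsUnit P ∧ IsUnit Q ∧ (∀ j, j ≠ 0 → (P * A * Q) 0 j = 0) ∧
      (∀ i, i ≠ 0 → (P * A * Q) i 0 = 0) ∧
      ∀ i j, (P * A * Q) i j ∈ Ideal.span {(P * A * Q) 0 0} := by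
  obtain ⟨p, hp⟩ := h.rows hZ A
  obtain ⟨U, ⟨U, rfl⟩, hU⟩ := h.hermite m p
  set V : Matrix (Fin (m + 1)) (Fin (m + 1)) R := (U⁻¹).val with hV
  set v := (V * A) 0 with hv
  -- p = g * row 0 of V
  have hpv : Matrix.vecMul p A = (Matrix.vecMul p U.val 0) • v := by
    have e1 : Matrix.vecMul p A = Matrix.vecMul (Matrix.vecMul p U.val) (V * A) := by
      rw [Matrix.vecMul_vecMul, ← Matrix.mul_assoc, hV, Units.mul_inv, Matrix.one_mul]
    rw [e1]
    funext k
    rw [Matrix.vecMul, dotProduct, Finset.sum_eq_single 0]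
    · simp [hv]
    · intro b _ hb; rw [hU b hb, zero_mul]
    · simp
  have hAv : ∀ i j, A i j ∈ I v := by
    intro i j
    have hle : I (Matrix.vecMul p A) ≤ I v := by
      rw [hpv, I_le]
      intro i
      exact Ideal.mul_mem_left _ _ (mem_I v i)
    exact hle (hp i j)
  obtain ⟨Q, hQ, hvQ⟩ := h.hermite n v
  set d := Matrix.vecMul v Q 0 with hd
  have hId : I v ≤ Ideal.span {d} := by
    rw [← h.I_vecMul v hQ, I_le]
    intro i
    by_cases hi : i = 0
    · rw [hi]; exact Ideal.mem_span_singleton_self _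
    · rw [hvQ i hi]; exact Ideal.zero_mem _
  set B := V * A * Q with hB
  have hB0 : ∀ j, B 0 j = Matrix.vecMul v Q j := fun j => rfl
  have hBd : ∀ i j, B i j ∈ Ideal.span {d} := h.mul_mem (fun i j => hId (hAv i j)) V Q
  choose y hy using fun i => Ideal.mem_span_singleton'.1 (hBd i 0)
  let z : Fin (m + 1) → R := fun i => if i = 0 then 0 else y i
  let N : Matrix (Fin (m + 1)) (Fin (m + 1)) R := Matrix.of fun i j => if j = 0 then z i else 0
  have hN : N * N = 0 := by
    ext i j
    rw [Matrix.mul_apply]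
    refine Finset.sum_eq_zero fun k _ => ?_
    by_cases hk : k = 0 <;> simp [N, z, hk]
  have hNu : IsUnit (1 - N) := by
    refine ⟨⟨1 - N, 1 + N, ?_, ?_⟩, rfl⟩
    · calc (1 - N) * (1 + N) = 1 - N * N := by noncomm_ring
        _ = 1 := by rw [hN, sub_zero]
    · calc (1 + N) * (1 - N) = 1 - N * N := by noncomm_ring
        _ = 1 := by rw [hN, sub_zero]
  have hent : ∀ i j, ((1 - N) * V * A * Q : Matrix (Fin (m + 1)) (Fin (n + 1)) R) i j = B i j - z i * B 0 j := by
    intro i j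
    have : (1 - N) * V * A * Q = B - N * B := by
      rw [hB]; simp only [Matrix.mul_assoc, Matrix.sub_mul, Matrix.one_mul]
    rw [this, Matrix.sub_apply, Matrix.mul_apply]
    simp [N]
  have hz0 : z 0 = 0 := by simp [z]
  have h00 : ((1 - N) * V * A * Q : Matrix (Fin (m + 1)) (Fin (n + 1)) R) 0 0 = d := by
    rw [hent, hz0, zero_mul, sub_zero]; rfl
  refine ⟨(1 - N) * V, Q, hNu.mul ⟨U⁻¹, rfl⟩, hQ, ?_, ?_, ?_⟩
  · intro j hj
    rw [hent, hz0, zero_mul, sub_zero, hB0, hvQ j hj]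
  · intro i hi
    rw [hent, hB0, ← hd, ← hy i]
    simp [z, hi]
  · intro i j
    rw [h00, hent]
    exact Ideal.sub_mem _ (hBd _ _) (Ideal.mul_mem_left _ _ (hBd _ _))

lemma BD.main (h : BD R)
    (hZ : ∀ a b : R, (∃ x y : R, a * x + b * y = 1) →
      ∃ y : R, IsFecklyAdequateElement (a + b * y)) : ElementaryDivisorRing R := by
  intro m
  induction m with
  | zero =>
    intro n A
    exact ⟨1, 1, isUnit_one, isUnit_one, fun i => i.elim0, fun i => i.elim0⟩
  | succ m ih =>
    intro n A
    cases n with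
    | zero =>
      exact ⟨1, 1, isUnit_one, isUnit_one, fun i j => j.elim0, fun i j => j.elim0⟩
    | succ n =>
      obtain ⟨P, Q, hP, hQ, hr, hc, hd⟩ := h.step hZ A
      set B := P * A * Q with hB
      obtain ⟨P', Q', hP', hQ', hoff, hdiv⟩ := ih n (B.submatrix Fin.succ Fin.succ)
      have sm := Fin.succ_injective m
      have sn := Fin.succ_injective n
      have e0 : emb Fin.succ P' * P * A * (Q * emb Fin.succ Q') =
          emb Fin.succ P' * B * emb Fin.succ Q' := by
        rw [hB]; simp only [Matrix.mul_assoc]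
      set D := emb Fin.succ P' * B * emb Fin.succ Q' with hD
      have l0 : ∀ j, (emb Fin.succ P' * B) 0 j = B 0 j := by
        intro j
        rw [Matrix.mul_apply]
        simp [emb_apply_left Fin.succ P' 0 _ (fun a => Fin.succ_ne_zero a), Matrix.one_apply]
      have ls : ∀ i j, (emb Fin.succ P' * B) (Fin.succ i) j = ∑ k, P' i k * B (Fin.succ k) j := by
        intro i j
        rw [Matrix.mul_apply, Fin.sum_univ_succ,
          emb_apply_right Fin.succ P' _ 0 (fun a => Fin.succ_ne_zero a),
          Matrix.one_apply_ne (Fin.succ_ne_zero i), zero_mul, zero_add]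
        simp only [emb_apply _ sm]
      have r0 : ∀ i, D i 0 = (emb Fin.succ P' * B) i 0 := fun i =>
        vecMul_emb_ne Fin.succ Q' _ 0 (fun a => Fin.succ_ne_zero a)
      have rs : ∀ i j, D i (Fin.succ j) =
          ∑ k, (emb Fin.succ P' * B) i (Fin.succ k) * Q' k j := fun i j =>
        vecMul_emb Fin.succ sn Q' _ j
      have D00 : D 0 0 = B 0 0 := by rw [r0, l0]
      have D0s : ∀ j, D 0 (Fin.succ j) = 0 := by
        intro j
        rw [rs]
        exact Finset.sum_eq_zero fun k _ => by rw [l0, hr _ (Fin.succ_ne_zero k), zero_mul]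
      have Ds0 : ∀ i, D (Fin.succ i) 0 = 0 := by
        intro i
        rw [r0, ls]
        exact Finset.sum_eq_zero fun k _ => by rw [hc _ (Fin.succ_ne_zero k), mul_zero]
      have Dss : ∀ i j, D (Fin.succ i) (Fin.succ j) =
          (P' * B.submatrix Fin.succ Fin.succ * Q') i j := by
        intro i j
        rw [rs, Matrix.mul_apply]
        refine Finset.sum_congr rfl fun k _ => ?_
        rw [ls, Matrix.mul_apply]; rfl
      have Dmem : ∀ i j, D i j ∈ Ideal.span {B 0 0} := h.mul_mem hd _ _
      refine ⟨emb Fin.succ P' * P, Q * emb Fin.succ Q', (emb_isUnit _ sm hP').mul hP,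
        hQ.mul (emb_isUnit _ sn hQ'), ?_, ?_⟩
      · rw [e0]
        intro i j
        refine Fin.cases ?_ (fun i => ?_) i <;> refine Fin.cases ?_ (fun j => ?_) j
        · intro hij; exact absurd rfl hij
        · intro _; exact D0s j
        · intro _; exact Ds0 i
        · intro hij
          rw [Dss]
          apply hoff
          simpa using hij
      · rw [e0]
        intro i j i' j' hij hij' hii' x y
        by_cases hi : i = 0
        · subst hi
          have hj : j = 0 := Fin.ext hij.symm
          subst hj
          have hm : x * D i' j' * y ∈ Ideal.span {D 0 0} := by
            rw [D00]
            exact h.two _ _ (Ideal.mul_mem_left _ _ (Dmem i' j')) _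
          obtain ⟨t, ht⟩ := Ideal.mem_span_singleton'.1 hm
          obtain ⟨t', ht'⟩ := h.toR (D 0 0) t
          exact ⟨⟨t', by rw [← ht, ht']⟩, ⟨t, ht.symm⟩⟩
        · have hiv : (i : ℕ) ≠ 0 := fun hh => hi (Fin.ext hh)
          have hj : j ≠ 0 := by rintro rfl; exact hiv hij
          have hi' : i' ≠ 0 := by rintro rfl; simp at hii'
          have hj' : j' ≠ 0 := by rintro rfl; simp at hij'; exact hi' hij'
          obtain ⟨i, rfl⟩ := Fin.exists_succ_eq.2 hi
          obtain ⟨j, rfl⟩ := Fin.exists_succ_eq.2 hj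
          obtain ⟨i', rfl⟩ := Fin.exists_succ_eq.2 hi'
          obtain ⟨j', rfl⟩ := Fin.exists_succ_eq.2 hj'
          rw [Dss, Dss]
          apply hdiv <;> simp_all
end Main
end ZabAux

/-- Every Zabavsky duo-domain is an elementary divisor ring: if `R` is a
Bézout duo-domain such that whenever `aR + bR = R` there is `y` with `a + by` feckly
adequate, then `R` is an elementary divisor ring. -/
theorem stmt14 (R : Type*) [Ring R] [IsDomain R]
    (hB : IsBezoutRing R) (hD : IsDuoRing R)
    (hZ : ∀ a b : R, (∃ x y : R, a * x + b * y = 1) →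
      ∃ y : R, IsFecklyAdequateElement (a + b * y)) :
    ElementaryDivisorRing R := by
  exact (ZabAux.BD.mk' hB hD).main hZ
end

section
/- Every adequate Bézout duo-domain is an elementary divisor ring; that is, if R is a Bézout duo-domain in which every nonzero element is adequate, then R is an elementary divisor ring. -/
/-- Completion of a row of length two over a right Bézout domain. -/
theorem aux_row2 {R : Type*} [Ring R] [IsDomain R]
    (hb : ∀ a b : R, ∃ x y : R, (a * x + b * y) ∣ a ∧ (a * x + b * y) ∣ b) (a b : R) :
    ∃ q00 q01 q10 q11 r00 r01 r10 r11 : R,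
      (q00 * r00 + q01 * r10 = 1 ∧ q00 * r01 + q01 * r11 = 0 ∧
       q10 * r00 + q11 * r10 = 0 ∧ q10 * r01 + q11 * r11 = 1) ∧
      (r00 * q00 + r01 * q10 = 1 ∧ r00 * q01 + r01 * q11 = 0 ∧
       r10 * q00 + r11 * q10 = 0 ∧ r10 * q01 + r11 * q11 = 1) ∧
      a * q01 + b * q11 = 0 := by
  by_cases hb0 : b = 0
  · subst hb0
    exact ⟨1, 0, 0, 1, 1, 0, 0, 1, by simp, by simp, by simp⟩
  obtain ⟨x, y, ⟨a', ha⟩, ⟨b', hb'⟩⟩ := hb a b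
  set d := a * x + b * y with hd
  have hd0 : d ≠ 0 := by
    rintro h; rw [h, zero_mul] at hb'; exact hb0 hb'
  have hb0' : b' ≠ 0 := by
    rintro h; rw [h, mul_zero] at hb'; exact hb0 hb'
  have h1 : a' * x + b' * y = 1 := by
    apply mul_left_cancel₀ hd0
    rw [mul_add, ← mul_assoc, ← mul_assoc, ← ha, ← hb', mul_one]
  obtain ⟨α, β, ⟨p, hp⟩, ⟨q, hq⟩⟩ := hb (1 - x * a') (-(x * b'))
  set u := (1 - x * a') * α + -(x * b') * β with hu
  set v := -(y * a') * α + (1 - y * b') * β with hv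
  have k1 : a' * (1 - x * a') + b' * (-(y * a')) = 0 := by
    have : a' * (1 - x * a') + b' * (-(y * a')) = (1 - (a' * x + b' * y)) * a' := by noncomm_ring
    rw [this, h1]; simp
  have k2 : a' * (-(x * b')) + b' * (1 - y * b') = 0 := by
    have : a' * (-(x * b')) + b' * (1 - y * b') = (1 - (a' * x + b' * y)) * b' := by noncomm_ring
    rw [this, h1]; simp
  have k3 : a' * u + b' * v = 0 := by
    have : a' * u + b' * v = (a' * (1 - x * a') + b' * (-(y * a'))) * α
        + (a' * (-(x * b')) + b' * (1 - y * b')) * β := by rw [hu, hv]; noncomm_ring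
    rw [this, k1, k2]; simp
  have hvp : -(y * a') = v * p := by
    apply mul_left_cancel₀ hb0'
    have e1 : b' * (-(y * a')) = -(a' * (u * p)) := by
      rw [← hp]; exact eq_neg_of_add_eq_zero_right k1
    have e2 : b' * v = -(a' * u) := eq_neg_of_add_eq_zero_right k3
    rw [e1, ← mul_assoc b', e2]; noncomm_ring
  have hvq : 1 - y * b' = v * q := by
    apply mul_left_cancel₀ hb0'
    have e1 : b' * (1 - y * b') = -(a' * (u * q)) := by
      rw [← hq]; exact eq_neg_of_add_eq_zero_right k2
    have e2 : b' * v = -(a' * u) := eq_neg_of_add_eq_zero_right k3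
    rw [e1, ← mul_assoc b', e2]; noncomm_ring
  have hu0 : u ≠ 0 := by
    intro h
    rw [h, zero_mul] at hp hq
    have : x = 0 := by
      rcases mul_eq_zero.1 (neg_eq_zero.1 hq) with h | h
      · exact h
      · exact absurd h hb0'
    rw [this] at hp; simp at hp
  refine ⟨x, u, y, v, a', b', p, q, ⟨?_, ?_, ?_, ?_⟩, ⟨h1, k3, ?_, ?_⟩, ?_⟩
  · rw [← hp]; abel
  · rw [← hq]; abel
  · rw [← hvp]; abel
  · rw [← hvq]; abel
  · apply mul_left_cancel₀ hu0
    have : u * (p * x + q * y) = (u * p) * x + (u * q) * y := by noncomm_ring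
    rw [this, ← hp, ← hq]
    have : (1 - x * a') * x + -(x * b') * y = x * (1 - (a' * x + b' * y)) := by noncomm_ring
    rw [this, h1]; simp
  · apply mul_left_cancel₀ hu0
    have : u * (p * u + q * v) = (u * p) * u + (u * q) * v := by noncomm_ring
    rw [this, ← hp, ← hq]
    have : (1 - x * a') * u + -(x * b') * v = u - x * (a' * u + b' * v) := by noncomm_ring
    rw [this, k3]; simp
  · have : a * u + b * v = d * (a' * u + b' * v) := by
      rw [mul_add d, ← mul_assoc d a', ← mul_assoc d b', ← ha, ← hb']
    rw [this, k3, mul_zero]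

theorem aux_row2u {R : Type*} [Ring R] [IsDomain R]
    (hb : ∀ a b : R, ∃ x y : R, (a * x + b * y) ∣ a ∧ (a * x + b * y) ∣ b) (v : Fin 2 → R) :
    ∃ Q : Matrix (Fin 2) (Fin 2) R, IsUnit Q ∧ Matrix.vecMul v Q 1 = 0 := by
  obtain ⟨q00, q01, q10, q11, r00, r01, r10, r11, ⟨h1, h2, h3, h4⟩, ⟨h5, h6, h7, h8⟩, h9⟩ :=
    aux_row2 hb (v 0) (v 1)
  refine ⟨!![q00, q01; q10, q11], ⟨⟨_, !![r00, r01; r10, r11], ?_, ?_⟩, rfl⟩, ?_⟩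
  · rw [Matrix.mul_fin_two, h1, h2, h3, h4, Matrix.one_fin_two]
  · rw [Matrix.mul_fin_two, h5, h6, h7, h8, Matrix.one_fin_two]
  · simp [Matrix.vecMul, dotProduct, Fin.sum_univ_two, h9]

theorem aux_col2u {R : Type*} [Ring R] [IsDomain R]
    (hb : ∀ a b : R, ∃ x y d : R, d = x * a + y * b ∧ (∃ k, a = k * d) ∧ (∃ k, b = k * d))
    (v : Fin 2 → R) :
    ∃ Q : Matrix (Fin 2) (Fin 2) R, IsUnit Q ∧ Matrix.mulVec Q v 1 = 0 := by
  have hb' : ∀ a b : Rᵐᵒᵖ, ∃ x y : Rᵐᵒᵖ, (a * x + b * y) ∣ a ∧ (a * x + b * y) ∣ b := by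
    intro a b
    obtain ⟨x, y, d, hd, ⟨k, hk⟩, ⟨l, hl⟩⟩ := hb a.unop b.unop
    refine ⟨.op x, .op y, ⟨.op k, ?_⟩, ⟨.op l, ?_⟩⟩
    · apply MulOpposite.unop_injective
      simpa [← hd] using hk
    · apply MulOpposite.unop_injective
      simpa [← hd] using hl
  obtain ⟨q00, q01, q10, q11, r00, r01, r10, r11, ⟨h1, h2, h3, h4⟩, ⟨h5, h6, h7, h8⟩, h9⟩ :=
    aux_row2 hb' (.op (v 0)) (.op (v 1))
  replace h1 := congrArg MulOpposite.unop h1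
  replace h2 := congrArg MulOpposite.unop h2
  replace h3 := congrArg MulOpposite.unop h3
  replace h4 := congrArg MulOpposite.unop h4
  replace h5 := congrArg MulOpposite.unop h5
  replace h6 := congrArg MulOpposite.unop h6
  replace h7 := congrArg MulOpposite.unop h7
  replace h8 := congrArg MulOpposite.unop h8
  replace h9 := congrArg MulOpposite.unop h9
  simp only [MulOpposite.unop_add, MulOpposite.unop_mul, MulOpposite.unop_one,
    MulOpposite.unop_zero, MulOpposite.unop_op] at h1 h2 h3 h4 h5 h6 h7 h8 h9
  refine ⟨!![q00.unop, q10.unop; q01.unop, q11.unop],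
    ⟨⟨_, !![r00.unop, r10.unop; r01.unop, r11.unop], ?_, ?_⟩, rfl⟩, ?_⟩
  · rw [Matrix.mul_fin_two, h5, h6, h7, h8, Matrix.one_fin_two]
  · rw [Matrix.mul_fin_two, h1, h2, h3, h4, Matrix.one_fin_two]
  · simp [Matrix.mulVec, dotProduct, Fin.sum_univ_two, h9]

/-- Embedding a unit along a split injection of coordinates. -/
theorem aux_embed {R : Type*} [Ring R] {ι κ : Type*} [Fintype ι] [DecidableEq ι] [Fintype κ]
    [DecidableEq κ] (C : Matrix ι κ R) (D : Matrix κ ι R) (h : D * C = 1)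
    (U : Matrix κ κ R) (hU : IsUnit U) : IsUnit (C * U * D + (1 - C * D)) := by
  have key : ∀ U V : Matrix κ κ R, U * V = 1 →
      (C * U * D + (1 - C * D)) * (C * V * D + (1 - C * D)) = 1 := by
    intro U V hUV
    have e1 : (C * U * D) * (C * V * D) = C * D := by
      calc _ = C * (U * ((D * C) * V)) * D := by simp only [Matrix.mul_assoc]
        _ = _ := by rw [h, Matrix.one_mul, hUV, Matrix.mul_one]
    have e2 : (C * U * D) * (C * D) = C * U * D := by
      calc _ = C * U * ((D * C) * D) := by simp only [Matrix.mul_assoc]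
        _ = _ := by rw [h, Matrix.one_mul]
    have e3 : (C * D) * (C * V * D) = C * V * D := by
      calc _ = C * ((D * C) * V * D) := by simp only [Matrix.mul_assoc]
        _ = _ := by rw [h, Matrix.one_mul]; simp only [Matrix.mul_assoc]
    have e4 : (C * D) * (C * D) = C * D := by
      calc _ = C * ((D * C) * D) := by simp only [Matrix.mul_assoc]
        _ = _ := by rw [h, Matrix.one_mul]
    rw [add_mul, mul_add, mul_add, e1, mul_sub, mul_one, e2, sub_mul, one_mul, e3, sub_mul,
      one_mul, mul_sub, mul_one, e4]
    abel
  obtain ⟨u, rfl⟩ := hU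
  exact ⟨⟨_, _, key _ _ u.mul_inv, key _ _ u.inv_mul⟩, rfl⟩

section emb
variable {R : Type*} [Ring R] {ι : Type*} [Fintype ι] [DecidableEq ι]

theorem aux_DC (f : Fin 2 → ι) (hf : Function.Injective f) :
    (1 : Matrix ι ι R).submatrix f id * (1 : Matrix ι ι R).submatrix id f = 1 := by
  ext a b
  simp [Matrix.mul_apply, Matrix.one_apply, hf.eq_iff]

theorem aux_row_step (hb : ∀ v : Fin 2 → R,
      ∃ Q : Matrix (Fin 2) (Fin 2) R, IsUnit Q ∧ Matrix.vecMul v Q 1 = 0)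
    (i j : ι) (hij : i ≠ j) (v : ι → R) :
    ∃ Q : Matrix ι ι R, IsUnit Q ∧ Matrix.vecMul v Q j = 0 ∧
      ∀ k, k ≠ i → k ≠ j → Matrix.vecMul v Q k = v k := by
  obtain ⟨f, hf0, hf1⟩ : ∃ f : Fin 2 → ι, f 0 = i ∧ f 1 = j := ⟨![i, j], rfl, rfl⟩
  obtain ⟨U, hU, h0⟩ := hb (v ∘ f)
  have hf : Function.Injective f := by
    intro a b; fin_cases a <;> fin_cases b <;> simp [hf0, hf1, hij, hij.symm]
  refine ⟨_, aux_embed _ _ (aux_DC (R := R) f hf) U hU, ?_, ?_⟩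
  · rw [Matrix.vecMul_add, Matrix.vecMul_sub, Matrix.vecMul_one, ← Matrix.vecMul_vecMul,
      ← Matrix.vecMul_vecMul, ← Matrix.vecMul_vecMul]
    have : Matrix.vecMul v ((1 : Matrix ι ι R).submatrix id f) = v ∘ f := by
      ext a; simp [Matrix.vecMul, dotProduct, Matrix.one_apply]
    rw [this]
    generalize Matrix.vecMul (v ∘ f) U = w at *
    simp [Matrix.vecMul, dotProduct, Matrix.one_apply, Fin.sum_univ_two, hf0, hf1, h0, hij, hij.symm]
  · intro k hki hkj
    rw [Matrix.vecMul_add, Matrix.vecMul_sub, Matrix.vecMul_one, ← Matrix.vecMul_vecMul,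
      ← Matrix.vecMul_vecMul, ← Matrix.vecMul_vecMul]
    generalize Matrix.vecMul v ((1 : Matrix ι ι R).submatrix id f) = w'
    generalize Matrix.vecMul w' U = w
    simp [Matrix.vecMul, dotProduct, Matrix.one_apply, Fin.sum_univ_two, hf0, hf1, hki.symm, hkj.symm]

theorem aux_col_step (hb : ∀ v : Fin 2 → R,
      ∃ Q : Matrix (Fin 2) (Fin 2) R, IsUnit Q ∧ Matrix.mulVec Q v 1 = 0)
    (i j : ι) (hij : i ≠ j) (v : ι → R) :
    ∃ Q : Matrix ι ι R, IsUnit Q ∧ Matrix.mulVec Q v j = 0 ∧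
      ∀ k, k ≠ i → k ≠ j → Matrix.mulVec Q v k = v k := by
  obtain ⟨f, hf0, hf1⟩ : ∃ f : Fin 2 → ι, f 0 = i ∧ f 1 = j := ⟨![i, j], rfl, rfl⟩
  obtain ⟨U, hU, h0⟩ := hb (v ∘ f)
  have hf : Function.Injective f := by
    intro a b; fin_cases a <;> fin_cases b <;> simp [hf0, hf1, hij, hij.symm]
  refine ⟨_, aux_embed _ _ (aux_DC (R := R) f hf) U hU, ?_, ?_⟩
  · rw [Matrix.add_mulVec, Matrix.sub_mulVec, Matrix.one_mulVec, ← Matrix.mulVec_mulVec,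
      ← Matrix.mulVec_mulVec, ← Matrix.mulVec_mulVec]
    have : Matrix.mulVec ((1 : Matrix ι ι R).submatrix f id) v = v ∘ f := by
      ext a; simp [Matrix.mulVec, dotProduct, Matrix.one_apply]
    rw [this]
    generalize Matrix.mulVec U (v ∘ f) = w at *
    simp [Matrix.mulVec, dotProduct, Matrix.one_apply, Fin.sum_univ_two, hf0, hf1, h0, hij, hij.symm]
  · intro k hki hkj
    rw [Matrix.add_mulVec, Matrix.sub_mulVec, Matrix.one_mulVec, ← Matrix.mulVec_mulVec,
      ← Matrix.mulVec_mulVec, ← Matrix.mulVec_mulVec]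
    generalize Matrix.mulVec ((1 : Matrix ι ι R).submatrix f id) v = w'
    generalize Matrix.mulVec U w' = w
    simp [Matrix.mulVec, dotProduct, Matrix.one_apply, Fin.sum_univ_two, hf0, hf1, hki, hkj]

theorem aux_row_herm (hb : ∀ v : Fin 2 → R,
      ∃ Q : Matrix (Fin 2) (Fin 2) R, IsUnit Q ∧ Matrix.vecMul v Q 1 = 0)
    (i : ι) (v : ι → R) :
    ∃ (Q : Matrix ι ι R) (d : R), IsUnit Q ∧ v = Matrix.vecMul (Pi.single i d) Q := by
  have key : ∀ S : Finset ι, i ∉ S → ∃ Q : Matrix ι ι R, IsUnit Q ∧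
      ∀ k ∈ S, Matrix.vecMul v Q k = 0 := by
    intro S
    induction S using Finset.induction_on with
    | empty => intro _; exact ⟨1, isUnit_one, by simp⟩
    | insert j S hj ih =>
      intro hi
      obtain ⟨Q, hQ, h⟩ := ih (fun h => hi (Finset.mem_insert_of_mem h))
      obtain ⟨Q', hQ', h1, h2⟩ := aux_row_step hb i j
        (fun h => hi (h ▸ Finset.mem_insert_self _ _)) (Matrix.vecMul v Q)
      refine ⟨Q * Q', hQ.mul hQ', ?_⟩
      intro k hk
      rw [← Matrix.vecMul_vecMul]
      rcases eq_or_ne k j with rfl | hkj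
      · exact h1
      · have hkS : k ∈ S := (Finset.mem_insert.1 hk).resolve_left hkj
        rw [h2 k (fun h => hi (h ▸ hk)) hkj, h k hkS]
  obtain ⟨_, ⟨Q, rfl⟩, h⟩ := key (Finset.univ.erase i) (by simp)
  refine ⟨(Q⁻¹ : (Matrix ι ι R)ˣ).val, Matrix.vecMul v Q.val i, Units.isUnit _, ?_⟩
  have : (Pi.single i (Matrix.vecMul v Q.val i) : ι → R) = Matrix.vecMul v Q.val := by
    ext k
    rcases eq_or_ne k i with rfl | hk
    · simp
    · rw [h k (by simp [hk])]; simp [hk]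
  rw [this, Matrix.vecMul_vecMul, Units.mul_inv, Matrix.vecMul_one]

theorem aux_col_herm (hb : ∀ v : Fin 2 → R,
      ∃ Q : Matrix (Fin 2) (Fin 2) R, IsUnit Q ∧ Matrix.mulVec Q v 1 = 0)
    (i : ι) (v : ι → R) :
    ∃ (Q : Matrix ι ι R) (d : R), IsUnit Q ∧ v = Matrix.mulVec Q (Pi.single i d) := by
  have key : ∀ S : Finset ι, i ∉ S → ∃ Q : Matrix ι ι R, IsUnit Q ∧
      ∀ k ∈ S, Matrix.mulVec Q v k = 0 := by
    intro S
    induction S using Finset.induction_on with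
    | empty => intro _; exact ⟨1, isUnit_one, by simp⟩
    | insert j S hj ih =>
      intro hi
      obtain ⟨Q, hQ, h⟩ := ih (fun h => hi (Finset.mem_insert_of_mem h))
      obtain ⟨Q', hQ', h1, h2⟩ := aux_col_step hb i j
        (fun h => hi (h ▸ Finset.mem_insert_self _ _)) (Matrix.mulVec Q v)
      refine ⟨Q' * Q, hQ'.mul hQ, ?_⟩
      intro k hk
      rw [← Matrix.mulVec_mulVec]
      rcases eq_or_ne k j with rfl | hkj
      · exact h1
      · have hkS : k ∈ S := (Finset.mem_insert.1 hk).resolve_left hkj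
        rw [h2 k (fun h => hi (h ▸ hk)) hkj, h k hkS]
  obtain ⟨_, ⟨Q, rfl⟩, h⟩ := key (Finset.univ.erase i) (by simp)
  refine ⟨(Q⁻¹ : (Matrix ι ι R)ˣ).val, Matrix.mulVec Q.val v i, Units.isUnit _, ?_⟩
  have : (Pi.single i (Matrix.mulVec Q.val v i) : ι → R) = Matrix.mulVec Q.val v := by
    ext k
    rcases eq_or_ne k i with rfl | hk
    · simp
    · rw [h k (by simp [hk])]; simp [hk]
  rw [this, Matrix.mulVec_mulVec, Units.inv_mul, Matrix.one_mulVec]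

end emb

/-- The key arithmetic step, using adequacy. -/
theorem aux_key {R : Type*} [Ring R] [IsDomain R]
    (hr : ∀ a r : R, ∃ r', r * a = a * r')
    (hl : ∀ a r : R, ∃ r', a * r = r' * a)
    (hb : ∀ a b : R, ∃ x y : R, (a * x + b * y) ∣ a ∧ (a * x + b * y) ∣ b)
    (a b c : R) (hA : IsAdequateElement c)
    (h1 : ∀ d : R, d ∣ a → d ∣ b → d ∣ c → IsUnit d) :
    ∃ p s t : R, p * a * s + b * s + c * t = 1 := by
  have dl : ∀ d a r : R, d ∣ a → d ∣ r * a := by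
    rintro d a r ⟨k, rfl⟩
    obtain ⟨r', h⟩ := hr d r
    exact ⟨r' * k, by rw [← mul_assoc, h, mul_assoc]⟩
  obtain ⟨r, s, rfl, ⟨x, y, hxy⟩, hs⟩ := hA a
  obtain ⟨p, hp⟩ := hl a (y * (1 - b))
  set z := p * a + b with hz
  have hzr : z + r * (x * (1 - b)) = 1 := by
    rw [hz, ← hp]
    have : a * (y * (1 - b)) + b + r * (x * (1 - b)) = (r * x + a * y) * (1 - b) + b := by
      noncomm_ring
    rw [this, hxy]; simp
  obtain ⟨α, β, hez, hes⟩ := hb z s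
  have hu : IsUnit (z * α + s * β) := by
    by_contra hne
    obtain ⟨γ, δ, hde, hda⟩ := hb (z * α + s * β) a
    apply hs _ hne hes
    have hdu : IsUnit ((z * α + s * β) * γ + a * δ) := by
      apply h1 _ hda
      · have : b = z - p * a := by rw [hz]; abel
        rw [this]
        exact dvd_sub (hde.trans hez) (dl _ _ _ hda)
      · exact dl _ _ _ (hde.trans hes)
    obtain ⟨w, hw⟩ := hdu.exists_right_inv
    refine ⟨γ * w, δ * w, ?_⟩
    rw [← mul_assoc, ← mul_assoc, ← add_mul, hw]
  obtain ⟨w, hw⟩ := hu.exists_right_inv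
  obtain ⟨r', hr'⟩ := hr z r
  refine ⟨p, 1 + r' * (α * w * (x * (1 - b))), β * w * (x * (1 - b)), ?_⟩
  rw [← add_mul, ← hz]
  calc z * (1 + r' * (α * w * (x * (1 - b)))) + r * s * (β * w * (x * (1 - b)))
      = z + (z * r') * (α * w * (x * (1 - b))) + r * s * (β * w * (x * (1 - b))) := by
        noncomm_ring
    _ = z + r * (((z * α + s * β) * w) * (x * (1 - b))) := by rw [← hr']; noncomm_ring
    _ = 1 := by rw [hw, one_mul, hzr]

theorem aux_two_s15 {R : Type*} [Ring R] [IsDomain R]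
    (hr : ∀ a r : R, ∃ r', r * a = a * r')
    (hl : ∀ a r : R, ∃ r', a * r = r' * a)
    (hb : ∀ a b : R, ∃ x y : R, (a * x + b * y) ∣ a ∧ (a * x + b * y) ∣ b)
    (hb' : ∀ a b : R, ∃ x y d : R, d = x * a + y * b ∧ (∃ k, a = k * d) ∧ (∃ k, b = k * d))
    (hA : ∀ c : R, c ≠ 0 → IsAdequateElement c) (a b c : R) :
    ∃ p q s t w : R, w = p * a * s + q * b * s + q * c * t ∧ w ∣ a ∧ w ∣ b ∧ w ∣ c := by
  by_cases hc : c = 0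
  · subst hc
    obtain ⟨x, y, d, hd, ⟨k, hk⟩, ⟨l, hl'⟩⟩ := hb' a b
    obtain ⟨k', hk'⟩ := hr d k
    obtain ⟨l', hl''⟩ := hr d l
    exact ⟨x, y, 1, 0, d, by simp [hd], ⟨k', by rw [← hk', ← hk]⟩,
      ⟨l', by rw [← hl'', ← hl']⟩, dvd_zero _⟩
  obtain ⟨x, y, he1, he2⟩ := hb a b
  obtain ⟨x', y', hg1, hg2⟩ := hb (a * x + b * y) c
  set e := a * x + b * y with he
  set g := e * x' + c * y' with hg
  obtain ⟨a1, ha⟩ := hg1.trans he1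
  obtain ⟨b1, hb1⟩ := hg1.trans he2
  obtain ⟨c1, hc1⟩ := hg2
  have hg0 : g ≠ 0 := by
    intro h; rw [h, zero_mul] at hc1; exact hc hc1
  have hc0 : c1 ≠ 0 := by
    intro h; rw [h, mul_zero] at hc1; exact hc hc1
  have h1 : (a1 * x + b1 * y) * x' + c1 * y' = 1 := by
    apply mul_left_cancel₀ hg0
    have : g * ((a1 * x + b1 * y) * x' + c1 * y')
      = ((g * a1) * x + (g * b1) * y) * x' + (g * c1) * y' := by noncomm_ring
    rw [this, ← ha, ← hb1, ← hc1, ← he, ← hg, mul_one]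
  obtain ⟨p, s, t, hpst⟩ := aux_key hr hl hb a1 b1 c1 (hA c1 hc0) (by
    intro d h2 h3 h4
    have : d ∣ 1 := by
      rw [← h1]
      exact dvd_add ((dvd_add (h2.mul_right _) (h3.mul_right _)).mul_right _) (h4.mul_right _)
    obtain ⟨k, hk⟩ := this
    exact IsUnit.of_mul_eq_one k hk.symm)
  obtain ⟨p', hp'⟩ := hl g p
  refine ⟨p', 1, s, t, g, ?_, ⟨a1, ha⟩, ⟨b1, hb1⟩, ⟨c1, hc1⟩⟩
  calc g = g * (p * a1 * s + b1 * s + c1 * t) := by rw [hpst, mul_one]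
    _ = (g * p) * a1 * s + (g * b1) * s + (g * c1) * t := by noncomm_ring
    _ = p' * (g * a1) * s + (g * b1) * s + (g * c1) * t := by rw [hp']; noncomm_ring
    _ = p' * a * s + 1 * b * s + 1 * c * t := by rw [← ha, ← hb1, ← hc1, one_mul, one_mul]

/-- The bilinear form of a matrix attains the gcd of the entries. -/
theorem aux_form {R : Type*} [Ring R]
    (hr : ∀ a r : R, ∃ r', r * a = a * r')
    (hv : ∀ (n : ℕ) (v : Fin n → R), ∃ q : Fin n → R, ∀ j, (v ⬝ᵥ q) ∣ v j)
    (h2 : ∀ a b c : R,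
      ∃ p q s t w : R, w = p * a * s + q * b * s + q * c * t ∧ w ∣ a ∧ w ∣ b ∧ w ∣ c)
    (n : ℕ) : ∀ (m : ℕ) (A : Matrix (Fin m) (Fin n) R),
      ∃ (p : Fin m → R) (q : Fin n → R), ∀ i j, (p ⬝ᵥ (A.mulVec q)) ∣ A i j := by
  have dl : ∀ d a r : R, d ∣ a → d ∣ r * a := by
    rintro d a r ⟨k, rfl⟩
    obtain ⟨r', h⟩ := hr d r
    exact ⟨r' * k, by rw [← mul_assoc, h, mul_assoc]⟩
  intro m
  induction m with
  | zero => intro A; exact ⟨0, 0, fun i => i.elim0⟩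
  | succ m ih =>
    intro A
    obtain ⟨p1, q1, h1⟩ := ih (fun i => A i.succ)
    obtain ⟨q2, hq2⟩ := hv n (A 0)
    set A1 : Matrix (Fin m) (Fin n) R := fun i => A i.succ with hA1
    set d := p1 ⬝ᵥ (A1.mulVec q1) with hd
    have hdd : d ∣ p1 ⬝ᵥ (A1.mulVec q2) := by
      refine Finset.dvd_sum fun i _ => dl _ _ _ ?_
      show d ∣ ∑ j, A1 i j * q2 j
      exact Finset.dvd_sum fun j _ => (h1 i j).mul_right _
    obtain ⟨b, hb⟩ := hdd
    obtain ⟨x, y, s, t, w, hw, ha, hf, hh⟩ :=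
      h2 d (A 0 ⬝ᵥ q1) (A 0 ⬝ᵥ q2 - (A 0 ⬝ᵥ q1) * b)
    have he : w ∣ A 0 ⬝ᵥ q2 := by
      have := dvd_add hh (hf.mul_right b)
      simpa using this
    -- right scaling of vectors
    have sc : ∀ (u q : Fin n → R) (k : R), (u ⬝ᵥ fun j => q j * k) = (u ⬝ᵥ q) * k := by
      intro u q k; simp [dotProduct, Finset.sum_mul, mul_assoc]
    have sc' : ∀ (q : Fin n → R) (k : R),
        (p1 ⬝ᵥ (A1.mulVec fun j => q j * k)) = (p1 ⬝ᵥ (A1.mulVec q)) * k := by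
      intro q k
      rw [Matrix.dotProduct_mulVec, Matrix.dotProduct_mulVec, sc]
    let q : Fin n → R := (fun j => q1 j * s) + ((fun j => q2 j * t) - (fun j => q1 j * (b * t)))
    have hval : (Fin.cons y (fun i => x * p1 i) : Fin (m+1) → R) ⬝ᵥ (A.mulVec q) = w := by
      have e1 : (Fin.cons y (fun i => x * p1 i) : Fin (m+1) → R) ⬝ᵥ (A.mulVec q)
          = y * (A 0 ⬝ᵥ q) + x * (p1 ⬝ᵥ (A1.mulVec q)) := by
        simp only [dotProduct, Fin.sum_univ_succ (n := m), Fin.cons_zero, Fin.cons_succ,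
          Finset.mul_sum, Matrix.mulVec, hA1, mul_assoc]
      have e2 : A 0 ⬝ᵥ q = (A 0 ⬝ᵥ q1) * s + ((A 0 ⬝ᵥ q2) * t - (A 0 ⬝ᵥ q1) * (b * t)) := by
        simp only [q, dotProduct_add, dotProduct_sub, sc]
      have e3 : p1 ⬝ᵥ (A1.mulVec q) = d * s := by
        simp only [q, Matrix.mulVec_add, Matrix.mulVec_sub, dotProduct_add, dotProduct_sub, sc']
        rw [hb, ← hd]; noncomm_ring
      rw [e1, e2, e3, hw]; noncomm_ring
    refine ⟨Fin.cons y (fun i => x * p1 i), q, fun i j => ?_⟩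
    rw [hval]
    refine Fin.cases ?_ (fun i => ?_) i
    · exact he.trans (hq2 j)
    · exact ha.trans (h1 i j)

/-- Block diagonal matrix with a scalar in the upper left corner. -/
def auxCons {R : Type*} [Ring R] {m n : ℕ} (b : R) (A : Matrix (Fin m) (Fin n) R) :
    Matrix (Fin (m+1)) (Fin (n+1)) R :=
  Matrix.of (Fin.cons (Fin.cons b 0) (fun i => Fin.cons 0 (A i)))

theorem auxCons_mul {R : Type*} [Ring R] {m n k : ℕ} (b c : R) (A : Matrix (Fin m) (Fin n) R)
    (B : Matrix (Fin n) (Fin k) R) :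
    auxCons b A * auxCons c B = auxCons (b * c) (A * B) := by
  ext i j
  rw [Matrix.mul_apply, Fin.sum_univ_succ]
  refine Fin.cases ?_ (fun i => ?_) i <;> refine Fin.cases ?_ (fun j => ?_) j <;>
    simp [auxCons, Matrix.mul_apply]

theorem auxCons_one {R : Type*} [Ring R] {m : ℕ} :
    auxCons (1 : R) (1 : Matrix (Fin m) (Fin m) R) = 1 := by
  ext i j
  refine Fin.cases ?_ (fun i => ?_) i <;> refine Fin.cases ?_ (fun j => ?_) j <;>
    simp [auxCons, Matrix.one_apply, Fin.succ_ne_zero, (Fin.succ_ne_zero _).symm]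

theorem auxCons_unit {R : Type*} [Ring R] {m : ℕ} (U : Matrix (Fin m) (Fin m) R)
    (hU : IsUnit U) : IsUnit (auxCons (1 : R) U) := by
  obtain ⟨u, rfl⟩ := hU
  exact ⟨⟨auxCons 1 u.val, auxCons 1 (u⁻¹).val, by rw [auxCons_mul, u.mul_inv, one_mul, auxCons_one],
    by rw [auxCons_mul, u.inv_mul, one_mul, auxCons_one]⟩, rfl⟩

theorem aux_unip {S : Type*} [Ring S] (N : S) (h : N * N = 0) : IsUnit (1 - N) :=
  ⟨⟨1 - N, 1 + N, by rw [mul_add, sub_mul, sub_mul, h]; simp,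
    by rw [mul_sub, add_mul, add_mul, h]; simp⟩, rfl⟩

/-- Clearing the first row and column. -/
theorem aux_clear {R : Type*} [Ring R] {m n : ℕ} (B : Matrix (Fin (m+1)) (Fin (n+1)) R)
    (l : Fin m → R) (r : Fin n → R) (hl : ∀ i, B i.succ 0 = l i * B 0 0)
    (hr : ∀ j, B 0 j.succ = B 0 0 * r j) :
    ∃ (P : Matrix (Fin (m+1)) (Fin (m+1)) R) (Q : Matrix (Fin (n+1)) (Fin (n+1)) R)
      (A' : Matrix (Fin m) (Fin n) R), IsUnit P ∧ IsUnit Q ∧ P * B * Q = auxCons (B 0 0) A' := by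
  let N : Matrix (Fin (m+1)) (Fin (m+1)) R :=
    Matrix.of (Fin.cons 0 (fun i => Fin.cons (l i) 0))
  let M : Matrix (Fin (n+1)) (Fin (n+1)) R := Matrix.of (Fin.cons (Fin.cons 0 r) 0)
  have hN : N * N = 0 := by
    ext i j
    rw [Matrix.mul_apply, Fin.sum_univ_succ]
    refine Fin.cases ?_ (fun i => ?_) i <;> simp [N]
  have hM : M * M = 0 := by
    ext i j
    rw [Matrix.mul_apply, Fin.sum_univ_succ]
    refine Fin.cases ?_ (fun i => ?_) i <;> simp [M]
  refine ⟨1 - N, 1 - M, ((1 - N) * B * (1 - M)).submatrix Fin.succ Fin.succ,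
    aux_unip N hN, aux_unip M hM, ?_⟩
  have hNB0 : ∀ j, (N * B) 0 j = 0 := by
    intro j; simp [Matrix.mul_apply, N]
  have hNBs : ∀ i j, (N * B) (Fin.succ i) j = l i * B 0 j := by
    intro i j; rw [Matrix.mul_apply, Fin.sum_univ_succ]; simp [N]
  have hX0 : ∀ (X : Matrix (Fin (m+1)) (Fin (n+1)) R) i, (X * M) i 0 = 0 := by
    intro X i; rw [Matrix.mul_apply, Fin.sum_univ_succ]; simp [M]
  have hXs : ∀ (X : Matrix (Fin (m+1)) (Fin (n+1)) R) i j,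
      (X * M) i (Fin.succ j) = X i 0 * r j := by
    intro X i j; rw [Matrix.mul_apply, Fin.sum_univ_succ]; simp [M]
  ext i j
  refine Fin.cases ?_ (fun i => ?_) i <;> refine Fin.cases ?_ (fun j => ?_) j
  · simp [auxCons, Matrix.mul_sub, Matrix.sub_mul, hX0, hNB0]
  · rw [Matrix.mul_sub, Matrix.sub_apply, hXs, Matrix.sub_mul]
    simp [auxCons, hNB0, hr]
  · rw [Matrix.mul_sub, Matrix.sub_apply, hX0, Matrix.sub_mul]
    simp [auxCons, hNBs, hl]
  · simp [auxCons]

theorem aux_dvd_mul {R : Type*} [Ring R]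
    (dl : ∀ d a r : R, d ∣ a → d ∣ r * a) {k m n o : ℕ} (g : R)
    (A : Matrix (Fin m) (Fin n) R) (P : Matrix (Fin k) (Fin m) R) (Q : Matrix (Fin n) (Fin o) R)
    (h : ∀ i j, g ∣ A i j) (i j) : g ∣ (P * A * Q) i j := by
  rw [Matrix.mul_apply]
  refine Finset.dvd_sum fun a _ => Dvd.dvd.mul_right ?_ _
  rw [Matrix.mul_apply]
  exact Finset.dvd_sum fun b _ => dl _ _ _ (h _ _)

/-- Every adequate Bézout duo-domain is an elementary divisor ring: if
every nonzero element of a Bézout duo-domain `R` is adequate, then `R` is an elementary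
divisor ring. -/
theorem stmt15 (R : Type*) [Ring R] [IsDomain R]
    (hB : IsBezoutRing R) (hD : IsDuoRing R)
    (hA : ∀ c : R, c ≠ 0 → IsAdequateElement c) :
    ElementaryDivisorRing R := by
  have hr : ∀ a r : R, ∃ r', r * a = a * r' := by
    intro a r
    have := hD.2 (Submodule.span Rᵐᵒᵖ {a}) a (Submodule.mem_span_singleton_self a) r
    obtain ⟨t, ht⟩ := Submodule.mem_span_singleton.1 this
    exact ⟨t.unop, ht.symm⟩
  have hl : ∀ a r : R, ∃ r', a * r = r' * a := by
    intro a r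
    have := hD.1 (Ideal.span {a}) a (Ideal.mem_span_singleton_self a) r
    obtain ⟨t, ht⟩ := Submodule.mem_span_singleton.1 this
    exact ⟨t, ht.symm⟩
  have hv : ∀ (n : ℕ) (v : Fin n → R), ∃ q : Fin n → R, ∀ j, (v ⬝ᵥ q) ∣ v j := by
    intro n v
    obtain ⟨d, hd⟩ := hB.2 (Submodule.span Rᵐᵒᵖ (Set.range v))
      (Submodule.fg_span (Set.finite_range v))
    have hd' : d ∈ Submodule.span Rᵐᵒᵖ (Set.range v) := by
      rw [hd]; exact Submodule.mem_span_singleton_self d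
    obtain ⟨c, hc⟩ := (Submodule.mem_span_range_iff_exists_fun _).1 hd'
    refine ⟨fun j => (c j).unop, fun j => ?_⟩
    have : (v ⬝ᵥ fun j => (c j).unop) = d := hc
    rw [this]
    have hj : v j ∈ Submodule.span Rᵐᵒᵖ {d} := by
      rw [← hd]; exact Submodule.subset_span ⟨j, rfl⟩
    obtain ⟨t, ht⟩ := Submodule.mem_span_singleton.1 hj
    exact ⟨t.unop, ht.symm⟩
  have hb : ∀ a b : R, ∃ x y : R, (a * x + b * y) ∣ a ∧ (a * x + b * y) ∣ b := by
    intro a b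
    obtain ⟨q, hq⟩ := hv 2 ![a, b]
    have e : (![a, b] ⬝ᵥ q) = a * q 0 + b * q 1 := by simp [dotProduct, Fin.sum_univ_two]
    rw [e] at hq
    exact ⟨q 0, q 1, hq 0, hq 1⟩
  have hb' : ∀ a b : R,
      ∃ x y d : R, d = x * a + y * b ∧ (∃ k, a = k * d) ∧ (∃ k, b = k * d) := by
    intro a b
    obtain ⟨d, hd⟩ := hB.1 (Ideal.span {a, b}) (Submodule.fg_span (by simp))
    have hd' : d ∈ Ideal.span {a, b} := by
      rw [hd]; exact Ideal.mem_span_singleton_self d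
    obtain ⟨x, y, hxy⟩ := Submodule.mem_span_pair.1 hd'
    have ha : a ∈ Ideal.span {d} := by rw [← hd]; exact Ideal.subset_span (by simp)
    have hb : b ∈ Ideal.span {d} := by rw [← hd]; exact Ideal.subset_span (by simp)
    obtain ⟨k, hk⟩ := Submodule.mem_span_singleton.1 ha
    obtain ⟨l, hl⟩ := Submodule.mem_span_singleton.1 hb
    exact ⟨x, y, d, hxy.symm, ⟨k, hk.symm⟩, ⟨l, hl.symm⟩⟩
  have dl : ∀ d a r : R, d ∣ a → d ∣ r * a := by
    rintro d a r ⟨k, rfl⟩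
    obtain ⟨r', h⟩ := hr d r
    exact ⟨r' * k, by rw [← mul_assoc, h, mul_assoc]⟩
  have main : ∀ (m n : ℕ) (A : Matrix (Fin m) (Fin n) R),
      ∃ (P : Matrix (Fin m) (Fin m) R) (Q : Matrix (Fin n) (Fin n) R), IsUnit P ∧ IsUnit Q ∧
        (∀ (i : Fin m) (j : Fin n), (i : ℕ) ≠ (j : ℕ) → (P * A * Q) i j = 0) ∧
        (∀ (i : Fin m) (j : Fin n) (i' : Fin m) (j' : Fin n),
          (i : ℕ) = (j : ℕ) → (i' : ℕ) = (j' : ℕ) → (i' : ℕ) = (i : ℕ) + 1 →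
          (P * A * Q) i j ∣ (P * A * Q) i' j') := by
    intro m
    induction m with
    | zero =>
      intro n A
      exact ⟨1, 1, isUnit_one, isUnit_one, fun i => i.elim0, fun i => i.elim0⟩
    | succ m ih =>
      intro n A
      cases n with
      | zero => exact ⟨1, 1, isUnit_one, isUnit_one, fun _ j => j.elim0, fun _ j => j.elim0⟩
      | succ n =>
        obtain ⟨p, q, hpq⟩ := aux_form hr hv (aux_two_s15 hr hl hb hb' hA) (n+1) (m+1) A
        obtain ⟨P0, d, hP0, hp⟩ := aux_row_herm (aux_row2u hb) 0 p
        obtain ⟨Q0, e, hQ0, hq⟩ := aux_col_herm (aux_col2u hb') 0 q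
        have hBd : ∀ i j, (P0 * A * Q0) 0 0 ∣ (P0 * A * Q0) i j := by
          intro i j
          refine dvd_trans ?_ (aux_dvd_mul dl _ A P0 Q0 hpq i j)
          have : p ⬝ᵥ (A.mulVec q) = d * ((P0 * A * Q0) 0 0 * e) := by
            rw [hp, hq, Matrix.dotProduct_mulVec, Matrix.vecMul_vecMul,
              Matrix.dotProduct_mulVec, Matrix.vecMul_vecMul]
            simp [Matrix.single_vecMul, dotProduct_single, mul_assoc]
          rw [this]
          exact dl _ _ _ (dvd_mul_right _ _)
        generalize hBdef : P0 * A * Q0 = B at hBd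
        have hl1 : ∀ i : Fin m, ∃ l, B i.succ 0 = l * B 0 0 := by
          intro i
          obtain ⟨k, hk⟩ := hBd i.succ 0
          obtain ⟨k', hk'⟩ := hl (B 0 0) k
          exact ⟨k', hk.trans hk'⟩
        choose l hl1 using hl1
        have hr1 : ∀ j : Fin n, ∃ k, B 0 j.succ = B 0 0 * k := fun j => hBd 0 j.succ
        choose r hr1 using hr1
        obtain ⟨P1, Q1, A', hP1, hQ1, h1⟩ := aux_clear B l r hl1 hr1
        have hA'd : ∀ i j, B 0 0 ∣ A' i j := by
          intro i j
          have := aux_dvd_mul dl _ B P1 Q1 hBd i.succ j.succ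
          rw [h1] at this
          simpa [auxCons] using this
        obtain ⟨P2, Q2, hP2, hQ2, hz, hdiv⟩ := ih n A'
        have hfin : (auxCons 1 P2 * P1 * P0) * A * (Q0 * Q1 * auxCons 1 Q2)
            = auxCons (B 0 0) (P2 * A' * Q2) := by
          calc _ = auxCons 1 P2 * (P1 * (P0 * A * Q0) * Q1) * auxCons 1 Q2 := by
                simp only [Matrix.mul_assoc]
            _ = _ := by rw [hBdef, h1, auxCons_mul, auxCons_mul, one_mul, mul_one]
        refine ⟨auxCons 1 P2 * P1 * P0, Q0 * Q1 * auxCons 1 Q2,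
          ((auxCons_unit _ hP2).mul hP1).mul hP0, (hQ0.mul hQ1).mul (auxCons_unit _ hQ2), ?_, ?_⟩
        · rw [hfin]
          intro i j
          refine Fin.cases ?_ (fun i => ?_) i <;> refine Fin.cases ?_ (fun j => ?_) j
          · simp
          · simp [auxCons]
          · simp [auxCons]
          · intro hij
            have := hz i j (by simpa using hij)
            simpa [auxCons] using this
        · rw [hfin]
          intro i j i' j' hij hij' hii
          have hi' : i' ≠ 0 := by rintro rfl; simp at hii
          have hj' : j' ≠ 0 := by rintro rfl; rw [hij'] at hii; simp at hii
          obtain ⟨i', rfl⟩ := Fin.exists_succ_eq.2 hi'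
          obtain ⟨j', rfl⟩ := Fin.exists_succ_eq.2 hj'
          revert hij hii
          refine Fin.cases ?_ (fun i => ?_) i <;> refine Fin.cases ?_ (fun j => ?_) j
          · intro _ _
            have := aux_dvd_mul dl _ A' P2 Q2 hA'd i' j'
            simpa [auxCons] using this
          · intro h; simp at h
          · intro h; simp at h
          · intro hij hii
            have := hdiv i j i' j' (by simpa using hij) (by simpa using hij') (by simpa using hii)
            simpa [auxCons] using this
  intro m n A
  obtain ⟨P, Q, hP, hQ, h1, h2⟩ := main m n A
  refine ⟨P, Q, hP, hQ, h1, ?_⟩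
  intro i j i' j' e1 e2 e3 x y
  have h : (P * A * Q) i j ∣ x * (P * A * Q) i' j' * y :=
    (dl _ _ _ (h2 i j i' j' e1 e2 e3)).mul_right _
  obtain ⟨u, hu⟩ := h
  obtain ⟨v, hv'⟩ := hl ((P * A * Q) i j) u
  exact ⟨⟨u, hu⟩, ⟨v, hu.trans hv'⟩⟩
end

section
/- Let R be a Bézout duo-domain such that for every a ∈ R, either a is adequate or 1 − a is adequate. Then R is an elementary divisor ring. -/
namespace BezoutDuo

open Matrix

variable {R : Type*} [Ring R]

/-- Block matrix `diag(1, M)`. -/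
def blk {n : ℕ} (M : Matrix (Fin n) (Fin n) R) : Matrix (Fin (n + 1)) (Fin (n + 1)) R :=
  Matrix.of (Fin.cons (Fin.cons 1 (fun _ => 0)) (fun i => Fin.cons 0 (M i)))

theorem blk_mul {n : ℕ} (M N : Matrix (Fin n) (Fin n) R) : blk M * blk N = blk (M * N) := by
  ext i j
  refine Fin.cases ?_ (fun i => ?_) i <;> refine Fin.cases ?_ (fun j => ?_) j <;>
    simp [blk, Matrix.mul_apply, Fin.sum_univ_succ]

theorem blk_one {n : ℕ} : blk (1 : Matrix (Fin n) (Fin n) R) = 1 := by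
  ext i j
  refine Fin.cases ?_ (fun i => ?_) i <;> refine Fin.cases ?_ (fun j => ?_) j <;>
    simp [blk, Matrix.one_apply, Fin.succ_ne_zero, (Fin.succ_ne_zero _).symm]

theorem isUnit_of_both {n : ℕ} {M N : Matrix (Fin n) (Fin n) R} (h1 : M * N = 1)
    (h2 : N * M = 1) : IsUnit M := ⟨⟨M, N, h1, h2⟩, rfl⟩

theorem both_of_isUnit {n : ℕ} {M : Matrix (Fin n) (Fin n) R} (h : IsUnit M) :
    ∃ N, M * N = 1 ∧ N * M = 1 := by
  obtain ⟨u, rfl⟩ := h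
  exact ⟨_, u.mul_inv, u.inv_mul⟩

theorem blk_isUnit {n : ℕ} {M : Matrix (Fin n) (Fin n) R} (h : IsUnit M) : IsUnit (blk M) := by
  obtain ⟨N, h1, h2⟩ := both_of_isUnit h
  exact isUnit_of_both (N := blk N) (by rw [blk_mul, h1, blk_one]) (by rw [blk_mul, h2, blk_one])

/-- The matrix `diag([[a, b], [c, d]], 1)`. -/
def emb {n : ℕ} (a b c d : R) : Matrix (Fin (n + 2)) (Fin (n + 2)) R :=
  Matrix.of (Fin.cons (Fin.cons a (Fin.cons b (fun _ => 0)))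
    (Fin.cons (Fin.cons c (Fin.cons d (fun _ => 0)))
      (fun i => Fin.cons 0 (Fin.cons 0 ((1 : Matrix (Fin n) (Fin n) R) i)))))

theorem emb_mul {n : ℕ} (a b c d a' b' c' d' : R) :
    emb (n := n) a b c d * emb a' b' c' d' =
      emb (a * a' + b * c') (a * b' + b * d') (c * a' + d * c') (c * b' + d * d') := by
  ext i j
  refine Fin.cases ?_ (fun i => Fin.cases ?_ (fun i => ?_) i) i <;>
    refine Fin.cases ?_ (fun j => Fin.cases ?_ (fun j => ?_) j) j <;>
    simp [emb, Matrix.mul_apply, Fin.sum_univ_succ, Matrix.one_apply]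

theorem emb_one {n : ℕ} : emb (n := n) (1 : R) 0 0 1 = 1 := by
  have : emb (n := n) (1 : R) 0 0 1 = blk (blk 1) := by
    ext i j
    refine Fin.cases ?_ (fun i => Fin.cases ?_ (fun i => ?_) i) i <;>
      refine Fin.cases ?_ (fun j => Fin.cases ?_ (fun j => ?_) j) j <;>
      simp [emb, blk]
  rw [this, blk_one, blk_one]

/-- Working properties of a Bezout duo domain. -/
structure BD (R : Type*) [Ring R] : Prop where
  gcd : ∀ a b : R, ∃ g x y : R, g ∣ a ∧ g ∣ b ∧ g = a * x + b * y
  swapL : ∀ a r : R, ∃ r', r * a = a * r'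
  swapR : ∀ a r : R, ∃ r', a * r = r' * a

theorem bd_of (hB : IsBezoutRing R) (hD : IsDuoRing R) : BD R := by
  refine ⟨fun a b => ?_, fun a r => ?_, fun a r => ?_⟩
  · obtain ⟨g, hg⟩ := hB.2 (Submodule.span Rᵐᵒᵖ {a, b}) (Submodule.fg_span (by simp))
    have ha : a ∈ Submodule.span Rᵐᵒᵖ {g} := hg ▸ Submodule.subset_span (by simp)
    have hb : b ∈ Submodule.span Rᵐᵒᵖ {g} := hg ▸ Submodule.subset_span (by simp)
    have hg' : g ∈ Submodule.span Rᵐᵒᵖ {a, b} := hg ▸ Submodule.subset_span (by simp)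
    obtain ⟨u, hu⟩ := Submodule.mem_span_singleton.1 ha
    obtain ⟨v, hv⟩ := Submodule.mem_span_singleton.1 hb
    obtain ⟨x, y, hxy⟩ := Submodule.mem_span_pair.1 hg'
    exact ⟨g, x.unop, y.unop, ⟨u.unop, by rw [← hu]; rfl⟩, ⟨v.unop, by rw [← hv]; rfl⟩,
      by rw [← hxy]; rfl⟩
  · have := hD.2 (Submodule.span Rᵐᵒᵖ {a}) a (Submodule.subset_span (by simp)) r
    obtain ⟨u, hu⟩ := Submodule.mem_span_singleton.1 this
    exact ⟨u.unop, by rw [← hu]; rfl⟩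
  · have := hD.1 (Ideal.span {a}) a (Submodule.subset_span (by simp)) r
    obtain ⟨u, hu⟩ := Submodule.mem_span_singleton.1 this
    exact ⟨u, by rw [← hu]; rfl⟩

/-- Right coprimality. -/
def Cop (a b : R) : Prop := ∃ x y : R, a * x + b * y = 1

theorem Cop.symm {a b : R} (h : Cop a b) : Cop b a := by
  obtain ⟨x, y, h⟩ := h
  exact ⟨y, x, by rw [add_comm]; exact h⟩

theorem BD.dvdL (H : BD R) {a b : R} (h : a ∣ b) (c : R) : a ∣ c * b := by
  obtain ⟨k, rfl⟩ := h
  obtain ⟨c', hc⟩ := H.swapL a c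
  exact ⟨c' * k, by rw [← mul_assoc, hc, mul_assoc]⟩

theorem BD.copL (H : BD R) {a b : R} (h : Cop a b) : ∃ x y : R, x * a + y * b = 1 := by
  obtain ⟨x, y, h⟩ := h
  obtain ⟨x', hx⟩ := H.swapR a x
  obtain ⟨y', hy⟩ := H.swapR b y
  exact ⟨x', y', by rw [← hx, ← hy, h]⟩

theorem BD.copR (H : BD R) {a b x y : R} (h : x * a + y * b = 1) : Cop a b := by
  obtain ⟨x', hx⟩ := H.swapL a x
  obtain ⟨y', hy⟩ := H.swapL b y
  exact ⟨x', y', by rw [← hx, ← hy, h]⟩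

theorem Cop.of_dvd {a b c : R} (h : Cop a b) (hc : c ∣ a) : Cop c b := by
  obtain ⟨x, y, h⟩ := h
  obtain ⟨k, rfl⟩ := hc
  exact ⟨k * x, y, by rw [← mul_assoc]; exact h⟩

/-- Euclid: `k` coprime to `r`, `k ∣ r * s` implies `k ∣ s`. -/
theorem BD.euclL (H : BD R) {k r s : R} (h : Cop k r) (hd : k ∣ r * s) : k ∣ s := by
  obtain ⟨x, y, h⟩ := H.copL h
  have : s = x * (k * s) + y * (r * s) := by
    rw [← mul_assoc, ← mul_assoc, ← add_mul, h, one_mul]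
  rw [this]
  exact dvd_add (H.dvdL (dvd_mul_right _ _) _) (H.dvdL hd _)

theorem BD.euclR (H : BD R) {k r s : R} (h : Cop k r) (hd : k ∣ s * r) : k ∣ s := by
  obtain ⟨x, y, h⟩ := h
  have : s = s * k * x + s * r * y := by
    rw [mul_assoc, mul_assoc, ← mul_add, h, mul_one]
  rw [this]
  exact dvd_add ((H.dvdL dvd_rfl _).mul_right _) (hd.mul_right _)

variable [IsDomain R]

theorem isUnit_of_dvd_one' {a : R} (h : a ∣ 1) : IsUnit a := by
  obtain ⟨b, hb⟩ := h
  have ha : a ≠ 0 := by rintro rfl; simp at hb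
  refine ⟨⟨a, b, hb.symm, ?_⟩, rfl⟩
  apply mul_left_cancel₀ ha
  rw [← mul_assoc, ← hb]; simp

theorem cop_of_no_common (H : BD R) {a b : R} (h : ∀ g, g ∣ a → g ∣ b → IsUnit g) : Cop a b := by
  obtain ⟨g, x, y, ha, hb, hg⟩ := H.gcd a b
  obtain ⟨u, rfl⟩ := h g ha hb
  refine ⟨x * (u⁻¹ : Rˣ), y * (u⁻¹ : Rˣ), ?_⟩
  rw [← mul_assoc, ← mul_assoc, ← add_mul, ← hg]; simp

theorem Cop.common {a b g : R} (h : Cop a b) (ha : g ∣ a) (hb : g ∣ b) : IsUnit g := by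
  obtain ⟨x, y, h⟩ := h
  exact isUnit_of_dvd_one' (h ▸ dvd_add (ha.mul_right _) (hb.mul_right _))

/-- A left factor of an adequate element is adequate. -/
theorem adequate_factor (H : BD R) {u v : R} (h : IsAdequateElement (u * v)) :
    IsAdequateElement u := by
  intro a
  obtain ⟨r, s, hrs, hra, hs⟩ := h a
  obtain ⟨g, x, y, ⟨s₁, hu⟩, ⟨r₁, hr⟩, hg⟩ := H.gcd u r
  by_cases hg0 : g = 0
  · subst hg0
    rw [zero_mul] at hu hr
    subst hu hr
    refine ⟨0, 1, by simp, hra, ?_⟩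
    rintro s' hs' ⟨w, hw⟩
    exact absurd (isUnit_of_dvd_one' ⟨w, hw⟩) hs'
  refine ⟨g, s₁, hu, Cop.of_dvd hra ⟨r₁, hr⟩, ?_⟩
  have hc : Cop s₁ r₁ := by
    obtain ⟨k, x', y', h1, h2, h3⟩ := H.gcd s₁ r₁
    refine ⟨x, y, mul_left_cancel₀ hg0 ?_⟩
    rw [mul_add, ← mul_assoc, ← mul_assoc, ← hu, ← hr, ← hg, mul_one]
  have hd : s₁ ∣ s := by
    apply H.euclL hc
    refine ⟨v, mul_left_cancel₀ hg0 ?_⟩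
    rw [← mul_assoc, ← mul_assoc, ← hr, ← hu, hrs]
  rintro s' hs' hdv
  exact hs s' hs' (Dvd.dvd.trans (show s' ∣ s₁ from hdv) hd)

theorem adequate_or (H : BD R) (h : ∀ a : R, IsAdequateElement a ∨ IsAdequateElement (1 - a))
    {a b : R} (hc : Cop a b) : IsAdequateElement a ∨ IsAdequateElement b := by
  obtain ⟨x, y, hxy⟩ := hc
  rcases h (a * x) with h | h
  · exact Or.inl (adequate_factor H h)
  · right
    rw [← hxy, add_sub_cancel_left] at h
    exact adequate_factor H h

theorem adequate_shift (H : BD R) {d e f : R} (hd : IsAdequateElement d)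
    (h1 : ∀ g, g ∣ e → g ∣ f → g ∣ d → IsUnit g) : ∃ y, Cop (e + f * y) d := by
  obtain ⟨r, s, hrs, hre, hs⟩ := hd e
  change Cop r e at hre
  refine ⟨r, cop_of_no_common H fun g hg hgd => ?_⟩
  by_contra hgu
  have hgr : Cop g r := by
    refine cop_of_no_common H fun k hkg hkr => hre.common hkr ?_
    have h2 := hkg.trans hg
    exact (dvd_add_left (H.dvdL hkr f)).1 h2
  have hgs : g ∣ s := H.euclL hgr (hrs ▸ hgd)
  refine hs g hgu hgs (cop_of_no_common H fun k hkg hke => ?_)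
  refine h1 k hke ?_ (hkg.trans hgd)
  apply H.euclR (hgr.of_dvd hkg)
  exact (dvd_add_right hke).1 (hkg.trans hg)

theorem hermite2 (H : BD R) (n : ℕ) (a b : R) : ∃ p q r s : R,
    IsUnit (emb (n := n) p q r s) ∧ a * q + b * s = 0 := by
  by_cases hb : b = 0
  · exact ⟨1, 0, 0, 1, by rw [emb_one]; exact isUnit_one, by simp [hb]⟩
  obtain ⟨g, x, y, ⟨a', rfl⟩, ⟨b', rfl⟩, hg⟩ := H.gcd a b
  have hg0 : g ≠ 0 := by rintro rfl; simp at hb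
  have hb' : b' ≠ 0 := by rintro rfl; simp at hb
  have hxy : a' * x + b' * y = 1 := by
    apply mul_left_cancel₀ hg0
    rw [mul_add, ← mul_assoc, ← mul_assoc, ← hg, mul_one]
  obtain ⟨a'', ha''⟩ := H.swapL b' a'
  obtain ⟨x', hx'⟩ := H.swapL b' x
  have hby : b' * y = 1 - a' * x := eq_sub_of_add_eq' hxy
  obtain ⟨s, hs⟩ : b' ∣ 1 - x * a' := by
    apply H.euclL (r := a') (Cop.symm ⟨x, y, hxy⟩)
    refine ⟨y * a', ?_⟩
    rw [← mul_assoc, hby]; noncomm_ring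
  have hsa : b' * (a'' * s) = b' * (y * a') := by
    rw [← mul_assoc, ← ha'', mul_assoc, ← hs, ← mul_assoc b', hby]; noncomm_ring
  have e1 : y * a' + -a'' * s = 0 := by
    rw [neg_mul, mul_left_cancel₀ hb' hsa]; simp
  have e2 : y * b' + -a'' * -x' = 1 := by
    apply mul_left_cancel₀ hb'
    rw [neg_mul_neg, mul_add, ← mul_assoc, ← mul_assoc b', ← ha'', mul_assoc a', ← hx', hby]
    noncomm_ring
  have e3 : s * x + -x' * y = 0 := by
    apply mul_left_cancel₀ hb'
    rw [mul_add, ← mul_assoc, ← hs, neg_mul, mul_neg, ← mul_assoc b', ← hx', mul_assoc x, hby]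
    noncomm_ring
  have e4 : s * b' + -x' * -a'' = 1 := by
    apply mul_left_cancel₀ hb'
    rw [neg_mul_neg, mul_add, ← mul_assoc, ← mul_assoc b', ← hs, ← hx', mul_assoc x, ← ha'']
    noncomm_ring
  refine ⟨x, b', y, -a'', isUnit_of_both (N := emb a' b' s (-x')) ?_ ?_, ?_⟩
  · rw [emb_mul, e1, e2, ← hs, mul_neg, ← hx', ← emb_one]; congr 1 <;> abel
  · rw [emb_mul, hxy, e3, e4, mul_neg, ha'', ← emb_one]; congr 1; abel
  · rw [mul_assoc, mul_assoc, mul_neg, ha'']; noncomm_ring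

theorem hermite (H : BD R) : ∀ (n : ℕ) (w : Fin (n + 1) → R),
    ∃ Q : Matrix (Fin (n + 1)) (Fin (n + 1)) R, IsUnit Q ∧ ∀ j : Fin n, (w ᵥ* Q) j.succ = 0
  | 0, w => ⟨1, isUnit_one, fun j => j.elim0⟩
  | n + 1, w => by
    obtain ⟨Q, hQ, hz⟩ := hermite H n (fun i => w i.succ)
    obtain ⟨p, q, r, s, hU, h0⟩ := hermite2 H n (w 0) (((fun i => w i.succ) ᵥ* Q) 0)
    refine ⟨blk Q * emb p q r s, (blk_isUnit hQ).mul hU, ?_⟩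
    have hw : w ᵥ* blk Q = Fin.cons (w 0) ((fun i => w i.succ) ᵥ* Q) := by
      ext j
      refine Fin.cases ?_ (fun j => ?_) j <;>
        simp [Matrix.vecMul, dotProduct, blk, Fin.sum_univ_succ]
    intro j
    rw [← Matrix.vecMul_vecMul, hw]
    generalize (fun i => w i.succ) ᵥ* Q = v at *
    refine Fin.cases ?_ (fun j => ?_) j
    · simp [Matrix.vecMul, dotProduct, emb, Fin.sum_univ_succ] at h0 ⊢
      exact h0
    · have := hz
      simp [Matrix.vecMul, dotProduct, emb, Fin.sum_univ_succ, hz]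

/-- `t` is a right combination of the entries of `w`. -/
def RS {n : ℕ} (w : Fin n → R) (t : R) : Prop := ∃ x : Fin n → R, t = w ⬝ᵥ x

theorem RS.mulL (H : BD R) {n : ℕ} {w : Fin n → R} {t : R} (h : RS w t) (c : R) :
    RS w (c * t) := by
  obtain ⟨x, rfl⟩ := h
  choose c' hc' using fun i => H.swapL (w i) c
  refine ⟨fun i => c' i * x i, ?_⟩
  simp only [dotProduct, Finset.mul_sum]
  refine Finset.sum_congr rfl fun i _ => ?_
  rw [← mul_assoc, hc', mul_assoc]

theorem RS.mulR {n : ℕ} {w : Fin n → R} {t : R} (h : RS w t) (c : R) : RS w (t * c) := by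
  obtain ⟨x, rfl⟩ := h
  refine ⟨fun i => x i * c, ?_⟩
  simp only [dotProduct, Finset.sum_mul, mul_assoc]

theorem RS.sum {n : ℕ} {w : Fin n → R} {ι : Type*} (s : Finset ι) (f : ι → R)
    (h : ∀ i, RS w (f i)) : RS w (∑ i ∈ s, f i) := by
  choose x hx using h
  refine ⟨∑ i ∈ s, x i, ?_⟩
  rw [dotProduct_sum]
  exact Finset.sum_congr rfl fun i _ => hx i

theorem RS.trans {n m : ℕ} {w : Fin n → R} {v : Fin m → R} {t : R} (h : RS w t)
    (hv : ∀ i, RS v (w i)) : RS v t := by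
  obtain ⟨x, rfl⟩ := h
  exact RS.sum _ _ fun i => (hv i).mulR _

theorem dvd_dot {n : ℕ} {w x : Fin n → R} {g : R} (h : ∀ i, g ∣ w i) : g ∣ w ⬝ᵥ x :=
  Finset.dvd_sum fun i _ => (h i).mul_right _

theorem vecgcd (H : BD R) : ∀ (n : ℕ) (f : Fin n → R),
    ∃ (g : R) (z : Fin n → R), g = f ⬝ᵥ z ∧ ∀ i, g ∣ f i
  | 0, f => ⟨0, 0, by simp, fun i => i.elim0⟩
  | n + 1, f => by
    obtain ⟨g, z, hg, hd⟩ := vecgcd H n (fun i => f i.succ)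
    obtain ⟨k, x, y, h1, h2, h3⟩ := H.gcd (f 0) g
    refine ⟨k, Fin.cons x (fun i => z i * y), ?_, fun i => ?_⟩
    · rw [h3, hg]
      simp [dotProduct, Fin.sum_univ_succ, Finset.sum_mul, mul_assoc]
    · refine Fin.cases h1 (fun i => h2.trans (hd i)) i

theorem dvd_of_hermite {n : ℕ} {w : Fin (n + 1) → R}
    {Q : Matrix (Fin (n + 1)) (Fin (n + 1)) R} (hQ : IsUnit Q) {g : R}
    (h : ∀ j, g ∣ (w ᵥ* Q) j) (i : Fin (n + 1)) : g ∣ w i := by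
  obtain ⟨N, h1, h2⟩ := both_of_isUnit hQ
  have : w = (w ᵥ* Q) ᵥ* N := by rw [Matrix.vecMul_vecMul, h1, Matrix.vecMul_one]
  rw [this]
  exact dvd_dot h

theorem dvd_of_hermite' {n : ℕ} {w : Fin (n + 1) → R}
    {Q : Matrix (Fin (n + 1)) (Fin (n + 1)) R} (hQ : IsUnit Q)
    (hz : ∀ j : Fin n, (w ᵥ* Q) j.succ = 0) {g : R} (h : g ∣ (w ᵥ* Q) 0)
    (i : Fin (n + 1)) : g ∣ w i :=
  dvd_of_hermite hQ (fun j => Fin.cases h (fun j => by rw [hz]; exact dvd_zero _) j) i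

theorem core (H : BD R) {n : ℕ} {α β : Fin (n + 1) → R}
    (h1 : ∀ g, (∀ i, g ∣ α i) → (∀ i, g ∣ β i) → IsUnit g)
    {Q : Matrix (Fin (n + 1)) (Fin (n + 1)) R} (hQ : IsUnit Q)
    (hz : ∀ j : Fin n, (β ᵥ* Q) j.succ = 0) (had : IsAdequateElement ((β ᵥ* Q) 0)) :
    ∃ x, Cop (α ⬝ᵥ x) (β ⬝ᵥ x) := by
  obtain ⟨f, z, hf, hfd⟩ := vecgcd H n (fun i => (α ᵥ* Q) i.succ)
  obtain ⟨y, hy⟩ := adequate_shift H (e := (α ᵥ* Q) 0) (f := f) had (by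
    intro g hg1 hg2 hg3
    refine h1 g (dvd_of_hermite hQ fun j => ?_) (dvd_of_hermite' hQ hz hg3)
    exact Fin.cases hg1 (fun j => hg2.trans (hfd j)) j)
  refine ⟨Q *ᵥ (Fin.cons 1 (fun i => z i * y)), ?_⟩
  rw [Matrix.dotProduct_mulVec, Matrix.dotProduct_mulVec]
  convert hy using 1
  · rw [hf]
    simp [dotProduct, Fin.sum_univ_succ, Finset.sum_mul, mul_assoc]
  · simp [dotProduct, Fin.sum_univ_succ, hz]

theorem two_rows_one (H : BD R)
    (h : ∀ a : R, IsAdequateElement a ∨ IsAdequateElement (1 - a)) {n : ℕ}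
    {α β : Fin (n + 1) → R}
    (h1 : ∀ g, (∀ i, g ∣ α i) → (∀ i, g ∣ β i) → IsUnit g) :
    ∃ (p q : R) (x : Fin (n + 1) → R), (fun k => p * α k + q * β k) ⬝ᵥ x = 1 := by
  obtain ⟨S, hS, hSz⟩ := hermite H n α
  obtain ⟨T, hT, hTz⟩ := hermite H n β
  have hc : Cop ((α ᵥ* S) 0) ((β ᵥ* T) 0) := cop_of_no_common H fun g ha hb =>
    h1 g (dvd_of_hermite' hS hSz ha) (dvd_of_hermite' hT hTz hb)
  have hx : ∃ x, Cop (α ⬝ᵥ x) (β ⬝ᵥ x) := by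
    rcases adequate_or H h hc with had | had
    · obtain ⟨x, hx⟩ := core H (fun g a b => h1 g b a) hS hSz had
      exact ⟨x, hx.symm⟩
    · exact core H h1 hT hTz had
  obtain ⟨x, hx⟩ := hx
  obtain ⟨p, q, hpq⟩ := H.copL hx
  refine ⟨p, q, x, ?_⟩
  rw [← hpq]
  simp [dotProduct, Finset.mul_sum, add_mul, Finset.sum_add_distrib, mul_assoc]

theorem two_rows (H : BD R)
    (h : ∀ a : R, IsAdequateElement a ∨ IsAdequateElement (1 - a)) {n : ℕ}
    (α β : Fin (n + 1) → R) :
    ∃ p q : R, (∀ i, RS (fun k => p * α k + q * β k) (α i)) ∧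
      (∀ i, RS (fun k => p * α k + q * β k) (β i)) := by
  obtain ⟨a, z, ha, had⟩ := vecgcd H _ α
  obtain ⟨b, z', hb, hbd⟩ := vecgcd H _ β
  obtain ⟨g, x, y, hga, hgb, hg⟩ := H.gcd a b
  have hα := fun i => hga.trans (had i)
  have hβ := fun i => hgb.trans (hbd i)
  by_cases hg0 : g = 0
  · subst hg0
    refine ⟨0, 0, fun i => ⟨0, ?_⟩, fun i => ⟨0, ?_⟩⟩
    · simpa using hα i
    · simpa using hβ i
  have key : ∀ t, g ∣ t → ∃ t', t = t' * g := by
    rintro t ⟨c, rfl⟩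
    exact H.swapR g c
  choose α' hα' using fun i => key _ (hα i)
  choose β' hβ' using fun i => key _ (hβ i)
  have kk : ∀ k t, k ∣ t → k * g ∣ t * g := by
    rintro k t ⟨c, rfl⟩
    obtain ⟨c', hc'⟩ := H.swapL g c
    exact ⟨c', by rw [mul_assoc, hc', mul_assoc]⟩
  obtain ⟨p, q, x, hx⟩ := two_rows_one H h (α := α') (β := β') (by
    intro k h1 h2
    have e1 : k * g ∣ a := by
      rw [ha]; exact dvd_dot fun i => by rw [hα']; exact kk _ _ (h1 i)
    have e2 : k * g ∣ b := by
      rw [hb]; exact dvd_dot fun i => by rw [hβ']; exact kk _ _ (h2 i)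
    have e3 : k * g ∣ g := by
      conv_rhs => rw [hg]
      exact dvd_add (e1.mul_right _) (e2.mul_right _)
    obtain ⟨u, hu⟩ := e3
    obtain ⟨u', hu'⟩ := H.swapR g u
    refine isUnit_of_dvd_one' ⟨u', mul_right_cancel₀ hg0 ?_⟩
    rw [one_mul, mul_assoc, ← hu', ← mul_assoc, ← hu])
  have fin : ∀ t, RS (fun k => p * α k + q * β k) (t * g) := by
    intro t
    choose c hc using fun k => H.swapL g (x k * t)
    refine ⟨c, ?_⟩
    rw [← one_mul t, ← hx]
    simp only [dotProduct, Finset.sum_mul]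
    refine Finset.sum_congr rfl fun k _ => ?_
    rw [hα', hβ', ← mul_assoc, ← mul_assoc, ← add_mul, mul_assoc _ g, ← hc]
    simp only [mul_assoc]
  exact ⟨p, q, fun i => by rw [hα' i]; exact fin _, fun i => by rw [hβ' i]; exact fin _⟩

theorem rows (H : BD R)
    (h : ∀ a : R, IsAdequateElement a ∨ IsAdequateElement (1 - a)) {n : ℕ} :
    ∀ (m : ℕ) (A : Matrix (Fin m) (Fin (n + 1)) R),
      ∃ p : Fin m → R, ∀ i j, RS (p ᵥ* A) (A i j)
  | 0, A => ⟨0, fun i => i.elim0⟩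
  | m + 1, A => by
    obtain ⟨p', hp'⟩ := rows H h m (Matrix.of fun i j => A i.succ j)
    obtain ⟨p, q, h1, h2⟩ := two_rows H h (A 0) (p' ᵥ* (Matrix.of fun i j => A i.succ j))
    refine ⟨Fin.cons p (fun i => q * p' i), ?_⟩
    have : (Fin.cons p (fun i => q * p' i) : Fin (m + 1) → R) ᵥ* A =
        fun k => p * A 0 k + q * (p' ᵥ* (Matrix.of fun i j => A i.succ j)) k := by
      ext k
      simp [Matrix.vecMul, dotProduct, Fin.sum_univ_succ, Finset.mul_sum, mul_assoc]
    rw [this]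
    intro i j
    refine Fin.cases (h1 j) (fun i => ?_) i
    exact (hp' i j).trans h2

/-- Block matrix `diag(g, B)`. -/
def bord {m n : ℕ} (g : R) (B : Matrix (Fin m) (Fin n) R) :
    Matrix (Fin (m + 1)) (Fin (n + 1)) R :=
  Matrix.of (Fin.cons (Fin.cons g (fun _ => 0)) (fun i => Fin.cons 0 (B i)))

theorem blk_bord {m n : ℕ} (g : R) (B : Matrix (Fin m) (Fin n) R)
    (P : Matrix (Fin m) (Fin m) R) (Q : Matrix (Fin n) (Fin n) R) :
    blk P * bord g B * blk Q = bord g (P * B * Q) := by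
  ext i j
  refine Fin.cases ?_ (fun i => ?_) i <;> refine Fin.cases ?_ (fun j => ?_) j <;>
    simp [blk, bord, Matrix.mul_apply, Fin.sum_univ_succ]

/-- Column clearing matrix. -/
def clr {m : ℕ} (c : Fin m → R) : Matrix (Fin (m + 1)) (Fin (m + 1)) R :=
  Matrix.of (Fin.cons (Fin.cons 1 (fun _ => 0))
    (fun i => Fin.cons (c i) ((1 : Matrix (Fin m) (Fin m) R) i)))

theorem clr_mul {m : ℕ} (c d : Fin m → R) : clr c * clr d = clr (c + d) := by
  ext i j
  refine Fin.cases ?_ (fun i => ?_) i <;> refine Fin.cases ?_ (fun j => ?_) j <;>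
    simp [clr, Matrix.mul_apply, Fin.sum_univ_succ, Matrix.one_apply]

theorem clr_zero {m : ℕ} : clr (0 : Fin m → R) = 1 := blk_one

theorem clr_isUnit {m : ℕ} (c : Fin m → R) : IsUnit (clr c) :=
  isUnit_of_both (N := clr (-c)) (by rw [clr_mul, add_neg_cancel, clr_zero])
    (by rw [clr_mul, neg_add_cancel, clr_zero])

theorem dvd_mat (H : BD R) {m n k l : ℕ} {A : Matrix (Fin m) (Fin n) R} {g : R}
    (h : ∀ i j, g ∣ A i j) (P : Matrix (Fin k) (Fin m) R) (Q : Matrix (Fin n) (Fin l) R)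
    (i : Fin k) (j : Fin l) : g ∣ (P * A * Q) i j := by
  rw [Matrix.mul_apply]
  refine Finset.dvd_sum fun s _ => Dvd.dvd.mul_right ?_ _
  rw [Matrix.mul_apply]
  exact Finset.dvd_sum fun t _ => H.dvdL (h _ _) _

theorem step (H : BD R)
    (h : ∀ a : R, IsAdequateElement a ∨ IsAdequateElement (1 - a)) {m n : ℕ}
    (A : Matrix (Fin (m + 1)) (Fin (n + 1)) R) :
    ∃ (P : Matrix (Fin (m + 1)) (Fin (m + 1)) R) (Q : Matrix (Fin (n + 1)) (Fin (n + 1)) R)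
      (g : R) (B : Matrix (Fin m) (Fin n) R), IsUnit P ∧ IsUnit Q ∧ P * A * Q = bord g B ∧
        ∀ i j, g ∣ B i j := by
  obtain ⟨p, hp⟩ := rows H h _ A
  obtain ⟨S, hS, hSz⟩ := hermite H m p
  obtain ⟨N, hN1, hN2⟩ := both_of_isUnit hS
  have hpN : p = fun k => (p ᵥ* S) 0 * N 0 k := by
    have : p = (p ᵥ* S) ᵥ* N := by rw [Matrix.vecMul_vecMul, hN1, Matrix.vecMul_one]
    ext k
    conv_lhs => rw [this]
    generalize p ᵥ* S = v at *
    simp [Matrix.vecMul, dotProduct, Fin.sum_univ_succ, hSz]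
  generalize (p ᵥ* S) 0 = u at hpN
  have hw : ∀ i j, RS (N 0 ᵥ* A) (A i j) := by
    intro i j
    refine (hp i j).trans fun k => ?_
    have : (p ᵥ* A) k = u * (N 0 ᵥ* A) k := by
      rw [hpN]
      simp [Matrix.vecMul, dotProduct, Finset.mul_sum, mul_assoc]
    rw [this]
    refine RS.mulL H ⟨Pi.single k 1, ?_⟩ u
    simp
  obtain ⟨Q, hQ, hQz⟩ := hermite H n (N 0 ᵥ* A)
  have hrow : ∀ j, (N * A * Q) 0 j = ((N 0 ᵥ* A) ᵥ* Q) j := by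
    intro j
    rfl
  have hgA : ∀ i j, ((N 0 ᵥ* A) ᵥ* Q) 0 ∣ A i j := by
    intro i j
    obtain ⟨x, hx⟩ := hw i j
    rw [hx]
    exact dvd_dot (dvd_of_hermite' hQ hQz dvd_rfl)
  have hgC := dvd_mat H hgA N Q
  generalize ((N 0 ᵥ* A) ᵥ* Q) = v at *
  have key : ∀ t, v 0 ∣ t → ∃ t', t = t' * v 0 := by
    rintro t ⟨c, rfl⟩
    exact H.swapR (v 0) c
  choose c hc using fun i : Fin m => key _ (hgC i.succ 0)
  refine ⟨clr (-c) * N, Q, v 0, Matrix.of fun i j => (N * A * Q) i.succ j.succ,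
    (clr_isUnit _).mul (isUnit_of_both hN2 hN1), hQ, ?_, fun i j => hgC _ _⟩
  rw [Matrix.mul_assoc, Matrix.mul_assoc, ← Matrix.mul_assoc N]
  generalize N * A * Q = C at *
  ext i j
  refine Fin.cases ?_ (fun i => ?_) i <;> refine Fin.cases ?_ (fun j => ?_) j <;>
    simp [clr, bord, Matrix.mul_apply, Fin.sum_univ_succ, hrow, hQz, hc, Matrix.one_apply]

theorem main (H : BD R)
    (h : ∀ a : R, IsAdequateElement a ∨ IsAdequateElement (1 - a)) :
    ∀ (m n : ℕ) (A : Matrix (Fin m) (Fin n) R), AdmitsDiagonalReduction A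
  | 0, n, A => ⟨1, 1, isUnit_one, isUnit_one, fun i => i.elim0, fun i => i.elim0⟩
  | m + 1, 0, A => ⟨1, 1, isUnit_one, isUnit_one, fun _ j => j.elim0, fun _ j => j.elim0⟩
  | m + 1, n + 1, A => by
    obtain ⟨P, Q, g, B, hP, hQ, hPQ, hg⟩ := step H h A
    obtain ⟨P', Q', hP', hQ', hz, hd⟩ := main H h m n B
    have hgD := dvd_mat H hg P' Q'
    have e : blk P' * P * A * (Q * blk Q') = bord g (P' * B * Q') := by
      rw [← blk_bord, ← hPQ]
      simp only [Matrix.mul_assoc]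
    refine ⟨blk P' * P, Q * blk Q', (blk_isUnit hP').mul hP, hQ.mul (blk_isUnit hQ'), ?_, ?_⟩
    · rw [e]
      generalize P' * B * Q' = D at *
      intro i j
      refine Fin.cases ?_ (fun i => ?_) i <;> refine Fin.cases ?_ (fun j => ?_) j
      · simp
      · simp [bord]
      · simp [bord]
      · intro hij
        simpa [bord] using hz i j (by simpa using hij)
    · rw [e]
      generalize P' * B * Q' = D at *
      intro i j i' j' hij hij' hi x y
      obtain ⟨i', rfl⟩ := Fin.exists_succ_eq.2 (show i' ≠ 0 by rintro rfl; simp at hi)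
      obtain ⟨j', rfl⟩ := Fin.exists_succ_eq.2
        (show j' ≠ 0 by rintro rfl; rw [hij'] at hi; simp at hi)
      have e1 : bord g D i'.succ j'.succ = D i' j' := by simp [bord]
      rw [e1]
      induction i using Fin.cases with
      | zero =>
        obtain rfl : j = 0 := Fin.ext (by simpa using hij.symm)
        have e2 : bord g D 0 0 = g := by simp [bord]
        rw [e2]
        obtain ⟨u, hu⟩ := (H.dvdL (hgD i' j') x).mul_right y
        obtain ⟨v, hv⟩ := H.swapR g u
        exact ⟨⟨u, hu⟩, ⟨v, hu.trans hv⟩⟩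
      | succ i =>
        obtain ⟨j, rfl⟩ := Fin.exists_succ_eq.2 (show j ≠ 0 by rintro rfl; simp at hij)
        have e2 : bord g D i.succ j.succ = D i j := by simp [bord]
        rw [e2]
        exact hd i j i' j' (by simpa using hij) (by simpa using hij') (by simpa using hi) x y

end BezoutDuo

/-- If `R` is a Bézout duo-domain such that for every `a` either `a` or
`1 - a` is adequate, then `R` is an elementary divisor ring. -/
theorem stmt16 (R : Type*) [Ring R] [IsDomain R]
    (hB : IsBezoutRing R) (hD : IsDuoRing R)
    (h : ∀ a : R, IsAdequateElement a ∨ IsAdequateElement (1 - a)) :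
    ElementaryDivisorRing R := by
  exact BezoutDuo.main (BezoutDuo.bd_of hB hD) h
end
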